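/- Let p>1, N≥1 and m>0. Then the characteristic function of any ball B⊂ℝ^N with |B|=m satisfies 𝒲_p(χ_B) ≥ 𝒲_p(ρ) for every ρ ∈ A_m, and moreover if ρ ∈ A_m satisfies 𝒲_p(ρ) = 𝒲_p(χ_B), then ρ coincides Lebesgue-almost everywhere with the characteristic function of a ball of volume m (i.e., maximizers are unique up to translation). -/

import Mathlib

open MeasureTheory ENNReal Set Metric Filter

noncomputable section

/-- Euclidean space `ℝ^N`. -/
abbrev Euc (N : ℕ) := EuclideanSpace ℝ (Fin N)

/-- The measure `ρ·γ` with density `ρ` with respect to `γ`. -/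
def densM {α : Type*} [MeasurableSpace α] (γ : Measure α) (ρ : α → ℝ) : Measure α :=
  γ.withDensity fun x => ENNReal.ofReal (ρ x)

/-- `π` is a transport plan (coupling) with marginals `μ` and `ν`. -/
def IsCoupling {α : Type*} [MeasurableSpace α] (π : Measure (α × α)) (μ ν : Measure α) : Prop :=
  π.map Prod.fst = μ ∧ π.map Prod.snd = ν

/-- Transport cost `∬ d(x,y)^p dπ(x,y)`. -/
def tCost {α : Type*} [MeasurableSpace α] [Dist α] (p : ℝ) (π : Measure (α × α)) : ℝ≥0∞ :=
  ∫⁻ z, ENNReal.ofReal (dist z.1 z.2 ^ p) ∂π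

/-- The `p`-th power `W_p(μ,ν)^p` of the `p`-Wasserstein distance. -/
def WpPow {α : Type*} [MeasurableSpace α] [Dist α] (p : ℝ) (μ ν : Measure α) : ℝ≥0∞ :=
  ⨅ (π : Measure (α × α)) (_ : IsCoupling π μ ν), tCost p π

/-- The `p`-Wasserstein distance `W_p(μ,ν)`. -/
def Wp {α : Type*} [MeasurableSpace α] [Dist α] (p : ℝ) (μ ν : Measure α) : ℝ≥0∞ :=
  WpPow p μ ν ^ (1 / p)

/-- `ρ'` is an admissible competitor for the energy `𝒲_p(ρ)`:
measurable, nonnegative, `ρ + ρ' ≤ 1` a.e., same total mass as `ρ`. -/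
def Adm {α : Type*} [MeasurableSpace α] (γ : Measure α) (ρ ρ' : α → ℝ) : Prop :=
  Measurable ρ' ∧ (∀ x, 0 ≤ ρ' x) ∧ (∀ᵐ x ∂γ, ρ x + ρ' x ≤ 1) ∧
    ∫⁻ x, ENNReal.ofReal (ρ' x) ∂γ = ∫⁻ x, ENNReal.ofReal (ρ x) ∂γ

/-- The `p`-th power `𝒲_p(ρ)^p` of the Wasserstein energy of a density `ρ`. -/
def WEnergyPow {α : Type*} [MeasurableSpace α] [Dist α] (p : ℝ) (γ : Measure α) (ρ : α → ℝ) :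
    ℝ≥0∞ :=
  ⨅ (ρ' : α → ℝ) (_ : Adm γ ρ ρ'), WpPow p (densM γ ρ) (densM γ ρ')

/-- The Wasserstein energy `𝒲_p(ρ) = inf { W_p(ργ, ρ'γ) : ρ' admissible }`. -/
def WEnergy {α : Type*} [MeasurableSpace α] [Dist α] (p : ℝ) (γ : Measure α) (ρ : α → ℝ) :
    ℝ≥0∞ :=
  WEnergyPow p γ ρ ^ (1 / p)

/-- The class `A_m` of densities with values in `[0,1]` and total mass `m`. -/
def memA {α : Type*} [MeasurableSpace α] (γ : Measure α) (m : ℝ) (ρ : α → ℝ) : Prop :=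
  Measurable ρ ∧ (∀ᵐ x ∂γ, 0 ≤ ρ x ∧ ρ x ≤ 1) ∧ ∫ x, ρ x ∂γ = m

/-- The class `AP_ρ` of admissible plans: first marginal `ργ`, second marginal `≤ (1-ρ)γ`. -/
def AP {α : Type*} [MeasurableSpace α] (γ : Measure α) (ρ : α → ℝ) (π : Measure (α × α)) : Prop :=
  π.map Prod.fst = densM γ ρ ∧ π.map Prod.snd ≤ densM γ fun x => 1 - ρ x

/-- `z` belongs to the support of the measure `μ`. -/
def inSupport {α : Type*} [TopologicalSpace α] [MeasurableSpace α] (μ : Measure α) (z : α) :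
    Prop :=
  ∀ U : Set α, IsOpen U → z ∈ U → 0 < μ U

section

lemma bm_one {A B C : Set ℝ} (hA : MeasurableSet A) (hB : MeasurableSet B)
    (hAn : A.Nonempty) (hBn : B.Nonempty) (h : ∀ x ∈ A, ∀ y ∈ B, x + y ∈ C) :
    volume A + volume B ≤ volume C := by
  have key : ∀ K L : Set ℝ, K ⊆ A → L ⊆ B → IsCompact K → IsCompact L →
      volume K + volume L ≤ volume C := by
    intro K L hKA hLB hK hL
    obtain ⟨x0, hx0⟩ := hAn
    obtain ⟨y0, hy0⟩ := hBn
    have hK' : IsCompact (insert x0 K) := hK.insert x0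
    have hL' : IsCompact (insert y0 L) := hL.insert y0
    obtain ⟨a, haK, ha⟩ := hK'.exists_isGreatest (insert_nonempty _ _)
    obtain ⟨b, hbL, hb⟩ := hL'.exists_isLeast (insert_nonempty _ _)
    have haA : a ∈ A := by rcases haK with rfl | h; exacts [hx0, hKA h]
    have hbB : b ∈ B := by rcases hbL with rfl | h; exacts [hy0, hLB h]
    have e1 : volume ((fun x => x + b) '' K) = volume K := by
      rw [Set.image_add_right]; simp
    have e2 : volume ((fun y => a + y) '' L) = volume L := by
      rw [Set.image_add_left]; simp
    have hKc : IsCompact ((fun x => x + b) '' K) := hK.image (by fun_prop)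
    rw [← e1, ← e2]
    have hd : AEDisjoint volume ((fun x => x + b) '' K) ((fun y => a + y) '' L) := by
      refine measure_mono_null (t := {a + b}) ?_ (by simp)
      rintro z ⟨⟨x, hx, rfl⟩, ⟨y, hy, hxy⟩⟩
      have h1 := ha (mem_insert_of_mem _ hx)
      have h2 := hb (mem_insert_of_mem _ hy)
      simp only [mem_singleton_iff] at *
      linarith
    rw [← measure_union₀' hKc.measurableSet.nullMeasurableSet hd]
    apply measure_mono
    rintro z (⟨x, hx, rfl⟩ | ⟨y, hy, rfl⟩)
    · exact h x (hKA hx) b hbB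
    · exact h a haA y (hLB hy)
  have h2 : ∀ K : Set ℝ, K ⊆ A → IsCompact K → volume K + volume B ≤ volume C := by
    intro K h1 h2
    rcases eq_or_ne (volume C) ⊤ with hC | hC
    · simp [hC]
    have hle : volume K ≤ volume C := le_trans le_self_add (key K ∅ h1 (empty_subset _) h2 isCompact_empty)
    have : volume B ≤ volume C - volume K := by
      rw [hB.measure_eq_iSup_isCompact]
      simp only [iSup_le_iff]
      intro L h3 h4
      exact ENNReal.le_sub_of_add_le_left (ne_top_of_le_ne_top hC hle) (key K L h1 h3 h2 h4)
    calc volume K + volume B ≤ volume K + (volume C - volume K) := by gcongr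
      _ = _ := add_tsub_cancel_of_le hle
  have h3 : volume A + volume B ≤ volume C := by
    rcases eq_or_ne (volume C) ⊤ with hC | hC
    · simp [hC]
    have hle : volume B ≤ volume C := by simpa using h2 ∅ (empty_subset _) isCompact_empty
    have : volume A ≤ volume C - volume B := by
      rw [hA.measure_eq_iSup_isCompact]
      simp only [iSup_le_iff]
      intro L h3 h4
      exact ENNReal.le_sub_of_add_le_right (ne_top_of_le_ne_top hC hle) (h2 L h3 h4)
    calc volume A + volume B ≤ (volume C - volume B) + volume B := by gcongr
      _ = _ := tsub_add_cancel_of_le hle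
  exact h3

end

section

lemma lint_layer {f : ℝ → ℝ≥0∞} (hf : Measurable f) (hf1 : ∀ x, f x ≤ 1) :
    ∫⁻ x, f x = ∫⁻ t in Ioo (0:ℝ) 1, volume {x | ENNReal.ofReal t < f x} := by
  have h1 : ∀ x, f x ≠ ⊤ := fun x => ne_top_of_le_ne_top one_ne_top (hf1 x)
  have := lintegral_eq_lintegral_meas_lt (volume : Measure ℝ) (f := fun x => (f x).toReal)
    (Eventually.of_forall fun x => toReal_nonneg) hf.ennreal_toReal.aemeasurable
  simp only [ENNReal.ofReal_toReal (h1 _)] at this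
  rw [this, ← lintegral_indicator measurableSet_Ioi, ← lintegral_indicator measurableSet_Ioo]
  refine lintegral_congr_ae (ae_of_all _ fun t => ?_)
  simp only [indicator, mem_Ioi, mem_Ioo]
  by_cases h0 : 0 < t
  · by_cases ht : t < 1
    · simp only [h0, ht, and_self, if_true]
      congr 1; ext x
      simp only [mem_ofPred_eq]
      rw [ENNReal.ofReal_lt_iff_lt_toReal h0.le (h1 x)]
    · simp only [h0, ht, if_true, and_false, if_false]
      have : {a | t < (f a).toReal} = ∅ := by
        ext x; simp only [mem_ofPred_eq, mem_empty_iff_false, iff_false, not_lt]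
        exact (toReal_mono one_ne_top (hf1 x)).trans (by simpa using ht)
      simp [this]
  · simp [h0]

lemma amgm_enn (u v : ℝ≥0∞) {l : ℝ} (h0 : 0 < l) (h1 : l < 1) :
    u ^ (1 - l) * v ^ l ≤ ENNReal.ofReal (1 - l) * u + ENNReal.ofReal l * v := by
  have h1' : 0 < 1 - l := by linarith
  have hc : (1/(1-l)).HolderConjugate (1/l) := by
    rw [Real.holderConjugate_iff]
    constructor
    · rw [lt_div_iff₀ h1']; linarith
    · simp
  have := ENNReal.young_inequality (u ^ (1-l)) (v^l) hc
  rw [← ENNReal.rpow_mul, ← ENNReal.rpow_mul, mul_one_div_cancel h1'.ne', mul_one_div_cancel h0.ne',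
    ENNReal.rpow_one, ENNReal.rpow_one] at this
  refine this.trans (le_of_eq ?_)
  rw [ENNReal.div_eq_inv_mul, ENNReal.div_eq_inv_mul, ← ENNReal.ofReal_inv_of_pos (by positivity),
    ← ENNReal.ofReal_inv_of_pos (by positivity)]
  simp

lemma pl_one_norm {f g h : ℝ → ℝ≥0∞} (hf : Measurable f) (hg : Measurable g) (hh : Measurable h)
    {l : ℝ} (h0 : 0 < l) (h1 : l < 1)
    (hs : ∀ x y, f x ^ (1 - l) * g y ^ l ≤ h ((1 - l) * x + l * y))
    (hF : ⨆ x, f x = 1) (hG : ⨆ x, g x = 1) :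
    (∫⁻ x, f x) ^ (1 - l) * (∫⁻ x, g x) ^ l ≤ ∫⁻ x, h x := by
  have h1' : 0 < 1 - l := by linarith
  have hf1 : ∀ x, f x ≤ 1 := fun x => hF ▸ le_iSup f x
  have hg1 : ∀ x, g x ≤ 1 := fun x => hG ▸ le_iSup g x
  refine (amgm_enn _ _ h0 h1).trans ?_
  refine le_trans ?_ (lintegral_mono (fun x => min_le_left (h x) 1))
  rw [lint_layer hf hf1, lint_layer hg hg1,
    lint_layer (hh.min measurable_const) (fun x => min_le_right _ _)]
  rw [← lintegral_const_mul' _ _ ofReal_ne_top, ← lintegral_const_mul' _ _ ofReal_ne_top]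
  have hm : Measurable fun t : ℝ => ENNReal.ofReal (1 - l) * volume {x | ENNReal.ofReal t < f x} := by
    apply Measurable.const_mul
    apply Antitone.measurable
    intro s t hst
    apply measure_mono
    intro x hx
    exact lt_of_le_of_lt (ofReal_le_ofReal hst) hx
  rw [← lintegral_add_left hm]
  refine setLIntegral_mono' measurableSet_Ioo fun t ht => ?_
  have hA : {x | ENNReal.ofReal t < f x}.Nonempty := by
    have : ENNReal.ofReal t < ⨆ x, f x := by rw [hF]; simpa using ht.2
    obtain ⟨x, hx⟩ := lt_iSup_iff.1 this
    exact ⟨x, hx⟩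
  have hB : {x | ENNReal.ofReal t < g x}.Nonempty := by
    have : ENNReal.ofReal t < ⨆ x, g x := by rw [hG]; simpa using ht.2
    obtain ⟨x, hx⟩ := lt_iSup_iff.1 this
    exact ⟨x, hx⟩
  have mA : MeasurableSet {x | ENNReal.ofReal t < f x} := measurableSet_lt measurable_const hf
  have mB : MeasurableSet {x | ENNReal.ofReal t < g x} := measurableSet_lt measurable_const hg
  have e1 := Measure.addHaar_preimage_smul (volume : Measure ℝ) (inv_ne_zero h1'.ne')
    {x | ENNReal.ofReal t < f x}
  have e2 := Measure.addHaar_preimage_smul (volume : Measure ℝ) (inv_ne_zero h0.ne')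
    {x | ENNReal.ofReal t < g x}
  simp only [Module.finrank_self, pow_one, inv_inv, abs_of_pos h1', abs_of_pos h0] at e1 e2
  rw [← e1, ← e2]
  apply bm_one
  · exact mA.preimage (by fun_prop)
  · exact mB.preimage (by fun_prop)
  · obtain ⟨x, hx⟩ := hA
    refine ⟨(1-l) * x, ?_⟩
    simpa [h1'.ne'] using hx
  · obtain ⟨x, hx⟩ := hB
    refine ⟨l * x, ?_⟩
    simpa [h0.ne'] using hx
  · intro x hx y hy
    simp only [mem_preimage, smul_eq_mul, mem_ofPred_eq, lt_min_iff] at hx hy ⊢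
    refine ⟨?_, by simpa using ht.2⟩
    have := hs ((1-l)⁻¹ * x) (l⁻¹ * y)
    rw [mul_inv_cancel_left₀ h1'.ne', mul_inv_cancel_left₀ h0.ne'] at this
    refine lt_of_lt_of_le ?_ this
    calc ENNReal.ofReal t = ENNReal.ofReal t ^ (1-l) * ENNReal.ofReal t ^ l := by
          rw [← ENNReal.rpow_add _ _ (by simpa using ht.1) ofReal_ne_top]; simp
      _ < _ := ENNReal.mul_lt_mul (ENNReal.rpow_lt_rpow hx h1') (ENNReal.rpow_lt_rpow hy h0)

lemma pl_one_bdd {f g h : ℝ → ℝ≥0∞} (hf : Measurable f) (hg : Measurable g) (hh : Measurable h)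
    {l : ℝ} (h0 : 0 < l) (h1 : l < 1)
    (hs : ∀ x y, f x ^ (1 - l) * g y ^ l ≤ h ((1 - l) * x + l * y))
    (hF : ⨆ x, f x ≠ ⊤) (hG : ⨆ x, g x ≠ ⊤) :
    (∫⁻ x, f x) ^ (1 - l) * (∫⁻ x, g x) ^ l ≤ ∫⁻ x, h x := by
  have h1' : 0 < 1 - l := by linarith
  rcases eq_or_ne (⨆ x, f x) 0 with hF0 | hF0
  · have : ∀ x, f x = 0 := by simpa using hF0
    simp [this, h1', ENNReal.zero_rpow_of_pos]
  rcases eq_or_ne (⨆ x, g x) 0 with hG0 | hG0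
  · have : ∀ x, g x = 0 := by simpa using hG0
    simp [this, h0, ENNReal.zero_rpow_of_pos]
  set F := ⨆ x, f x
  set G := ⨆ x, g x
  have hFi : F⁻¹ ≠ ⊤ := by simpa using hF0
  have hGi : G⁻¹ ≠ ⊤ := by simpa using hG0
  have hFi0 : F⁻¹ ≠ 0 := by simpa using hF
  have hGi0 : G⁻¹ ≠ 0 := by simpa using hG
  have key := pl_one_norm (f := fun x => F⁻¹ * f x) (g := fun x => G⁻¹ * g x)
    (h := fun x => ((F⁻¹) ^ (1-l) * (G⁻¹)^l) * h x) (hf.const_mul _) (hg.const_mul _)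
    (hh.const_mul _) h0 h1 (by
      intro x y
      rw [ENNReal.mul_rpow_of_nonneg _ _ h1'.le, ENNReal.mul_rpow_of_nonneg _ _ h0.le,
        mul_mul_mul_comm]
      gcongr
      exact hs x y) (by rw [← ENNReal.mul_iSup]; exact ENNReal.inv_mul_cancel hF0 hF)
      (by rw [← ENNReal.mul_iSup]; exact ENNReal.inv_mul_cancel hG0 hG)
  have hc : (F⁻¹) ^ (1-l) * (G⁻¹)^l ≠ ⊤ :=
    ENNReal.mul_ne_top (rpow_ne_top_of_nonneg h1'.le hFi) (rpow_ne_top_of_nonneg h0.le hGi)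
  have hc0 : (F⁻¹) ^ (1-l) * (G⁻¹)^l ≠ 0 := by
    apply mul_ne_zero
    · exact (ENNReal.rpow_pos (pos_iff_ne_zero.2 hFi0) hFi).ne'
    · exact (ENNReal.rpow_pos (pos_iff_ne_zero.2 hGi0) hGi).ne'
  rw [lintegral_const_mul' _ _ hFi, lintegral_const_mul' _ _ hGi, lintegral_const_mul' _ _ hc,
    ENNReal.mul_rpow_of_nonneg _ _ h1'.le, ENNReal.mul_rpow_of_nonneg _ _ h0.le,
        mul_mul_mul_comm] at key
  exact (ENNReal.mul_le_mul_iff_right hc0 hc).1 key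

lemma pl_one {f g h : ℝ → ℝ≥0∞} (hf : Measurable f) (hg : Measurable g) (hh : Measurable h)
    {l : ℝ} (h0 : 0 < l) (h1 : l < 1)
    (hs : ∀ x y, f x ^ (1 - l) * g y ^ l ≤ h ((1 - l) * x + l * y)) :
    (∫⁻ x, f x) ^ (1 - l) * (∫⁻ x, g x) ^ l ≤ ∫⁻ x, h x := by
  have h1' : 0 < 1 - l := by linarith
  rcases eq_or_ne (∫⁻ x, f x) 0 with hF0 | hF0
  · simp [hF0, h1', ENNReal.zero_rpow_of_pos]
  rcases eq_or_ne (∫⁻ x, g x) 0 with hG0 | hG0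
  · simp [hG0, h0, ENNReal.zero_rpow_of_pos]
  have tr : ∀ f : ℝ → ℝ≥0∞, Measurable f →
      Tendsto (fun n : ℕ => ∫⁻ x, min (f x) n) atTop (nhds (∫⁻ x, f x)) := by
    intro f hf
    apply lintegral_tendsto_of_tendsto_of_monotone
    · intro n; exact (hf.min measurable_const).aemeasurable
    · refine ae_of_all _ fun x n k hnk => ?_
      exact min_le_min le_rfl (by exact_mod_cast hnk)
    · refine ae_of_all _ fun x => ?_
      have := (tendsto_const_nhds (x := f x) (f := atTop (α := ℕ))).min ENNReal.tendsto_nat_nhds_top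
      simpa using this
  have T := ENNReal.Tendsto.mul ((ENNReal.continuous_rpow_const (y := 1 - l)).tendsto _ |>.comp (tr f hf))
    (Or.inl (by simp only [ne_eq, ENNReal.rpow_eq_zero_iff]; rintro (⟨h,_⟩|⟨_,h⟩); exacts [hF0 h, by linarith]))
    ((ENNReal.continuous_rpow_const (y := l)).tendsto _ |>.comp (tr g hg))
    (Or.inl (by simp only [ne_eq, ENNReal.rpow_eq_zero_iff]; rintro (⟨h,_⟩|⟨_,h⟩); exacts [hG0 h, by linarith]))
  refine le_of_tendsto' T fun n => ?_
  have bd : ∀ f : ℝ → ℝ≥0∞, ⨆ x, min (f x) (n:ℝ≥0∞) ≠ ⊤ := fun f =>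
    ne_top_of_le_ne_top (ENNReal.natCast_ne_top n) (iSup_le fun x => min_le_right _ _)
  refine pl_one_bdd (hf.min measurable_const) (hg.min measurable_const) hh h0 h1 ?_ (bd f) (bd g)
  intro x y
  refine le_trans ?_ (hs x y)
  gcongr <;> exact min_le_left _ _

lemma pl_pi (n : ℕ) : ∀ {f g h : (Fin n → ℝ) → ℝ≥0∞} (_ : Measurable f) (_ : Measurable g)
    (_ : Measurable h) {l : ℝ} (_ : 0 < l) (_ : l < 1)
    (_ : ∀ x y, f x ^ (1 - l) * g y ^ l ≤ h ((1 - l) • x + l • y)),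
    (∫⁻ x, f x) ^ (1 - l) * (∫⁻ x, g x) ^ l ≤ ∫⁻ x, h x := by
  induction n with
  | zero =>
    intro f g h hf hg hh l h0 h1 hs
    have hv : (volume : Measure (Fin 0 → ℝ)) univ = 1 := by
      rw [volume_pi, Measure.pi_univ]; simp
    simp only [lintegral_unique, hv, mul_one]
    refine (hs _ _).trans (le_of_eq ?_)
    congr 1
    exact Subsingleton.elim _ _
  | succ n ih =>
    intro f g h hf hg hh l h0 h1 hs
    have e := volume_preserving_piFinSuccAbove (fun _ : Fin (n+1) => ℝ) 0
    have es := e.symm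
    have conv : ∀ f : (Fin (n+1) → ℝ) → ℝ≥0∞, Measurable f →
        ∫⁻ x, f x = ∫⁻ a : ℝ, ∫⁻ y : Fin n → ℝ, f ((MeasurableEquiv.piFinSuccAbove (fun _ => ℝ) 0).symm (a, y)) := by
      intro f hf
      rw [← es.lintegral_comp hf]
      exact lintegral_prod _ (hf.comp es.measurable).aemeasurable
    rw [conv f hf, conv g hg, conv h hh]
    have mm : ∀ f : (Fin (n+1) → ℝ) → ℝ≥0∞, Measurable f → Measurable fun a : ℝ =>
      ∫⁻ y : Fin n → ℝ, f ((MeasurableEquiv.piFinSuccAbove (fun _ => ℝ) 0).symm (a, y)) := by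
      intro f hf
      exact Measurable.lintegral_prod_right (hf.comp es.measurable)
    refine pl_one (mm f hf) (mm g hg) (mm h hh) h0 h1 ?_
    intro a b
    have ms : ∀ f : (Fin (n+1) → ℝ) → ℝ≥0∞, Measurable f → ∀ a : ℝ, Measurable fun y : Fin n → ℝ =>
      f ((MeasurableEquiv.piFinSuccAbove (fun _ => ℝ) 0).symm (a, y)) := by
      intro f hf a
      exact (hf.comp es.measurable).comp measurable_prodMk_left
    refine ih (ms f hf a) (ms g hg b) (ms h hh _) h0 h1 ?_
    intro x y
    refine (hs _ _).trans (le_of_eq ?_)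
    congr 1
    ext i
    refine Fin.cases ?_ (fun j => ?_) i <;> simp [MeasurableEquiv.piFinSuccAbove]

lemma pl_euc {n : ℕ} {f g h : Euc n → ℝ≥0∞} (hf : Measurable f) (hg : Measurable g)
    (hh : Measurable h) {l : ℝ} (h0 : 0 < l) (h1 : l < 1)
    (hs : ∀ x y, f x ^ (1 - l) * g y ^ l ≤ h ((1 - l) • x + l • y)) :
    (∫⁻ x, f x) ^ (1 - l) * (∫⁻ x, g x) ^ l ≤ ∫⁻ x, h x := by
  have e := (EuclideanSpace.volume_preserving_symm_measurableEquiv_toLp (Fin n)).symm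
  rw [← e.lintegral_comp hf, ← e.lintegral_comp hg, ← e.lintegral_comp hh]
  refine pl_pi n (hf.comp e.measurable) (hg.comp e.measurable) (hh.comp e.measurable) h0 h1 ?_
  intro x y
  exact hs _ _

end

section

/-- volume of the unit ball. -/
def om (N : ℕ) : ℝ := (volume (ball (0 : Euc N) 1)).toReal

/-- radius of the ball of volume `v`. -/
def rad (N : ℕ) (v : ℝ) : ℝ := (v / om N) ^ (1 / (N:ℝ))

lemma om_pos (N : ℕ) : 0 < om N :=
  toReal_pos (measure_ball_pos _ _ one_pos).ne' measure_ball_lt_top.ne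

lemma vol_ball {N : ℕ} (hN : 1 ≤ N) (x : Euc N) {s : ℝ} (hs : 0 ≤ s) :
    volume (ball x s) = ENNReal.ofReal (om N * s ^ N) := by
  haveI : Nonempty (Fin N) := ⟨⟨0, hN⟩⟩
  rw [Measure.addHaar_ball _ _ hs, finrank_euclideanSpace, Fintype.card_fin, mul_comm,
    ENNReal.ofReal_mul (om_pos N).le, om, ofReal_toReal measure_ball_lt_top.ne]

lemma rad_nonneg {N : ℕ} {v : ℝ} (hv : 0 ≤ v) : 0 ≤ rad N v :=
  Real.rpow_nonneg (div_nonneg hv (om_pos N).le) _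

lemma rad_pow {N : ℕ} (hN : 1 ≤ N) {v : ℝ} (hv : 0 ≤ v) : om N * rad N v ^ N = v := by
  rw [rad, one_div, Real.rpow_inv_natCast_pow (div_nonneg hv (om_pos N).le) (by omega),
    mul_div_cancel₀ _ (om_pos N).ne']

lemma rad_zero {N : ℕ} (hN : 1 ≤ N) : rad N 0 = 0 := by
  rw [rad, zero_div, Real.zero_rpow]
  have : (0:ℝ) < N := by exact_mod_cast hN
  positivity

lemma rad_of_pow {N : ℕ} (hN : 1 ≤ N) {s : ℝ} (hs : 0 ≤ s) : rad N (om N * s ^ N) = s := by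
  rw [rad, mul_div_cancel_left₀ _ (om_pos N).ne', one_div, Real.pow_rpow_inv_natCast hs (by omega)]

lemma vol_ball_rad {N : ℕ} (hN : 1 ≤ N) (x : Euc N) {v : ℝ} (hv : 0 ≤ v) :
    volume (ball x (rad N v)) = ENNReal.ofReal v := by
  rw [vol_ball hN _ (rad_nonneg hv), rad_pow hN hv]

lemma rad_lt {N : ℕ} (hN : 1 ≤ N) {v w : ℝ} (hv : 0 ≤ v) (h : v < w) : rad N v < rad N w := by
  have : (0:ℝ) < N := by exact_mod_cast hN
  have := om_pos N
  exact Real.rpow_lt_rpow (by positivity) (by gcongr) (by positivity)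

lemma rad_le {N : ℕ} {v w : ℝ} (hv : 0 ≤ v) (h : v ≤ w) : rad N v ≤ rad N w := by
  have := om_pos N
  exact Real.rpow_le_rpow (by positivity) (by gcongr) (by positivity)

lemma rad_cont (N : ℕ) : Continuous (rad N) := by
  unfold rad
  exact (continuous_id.div_const _).rpow_const (fun x => Or.inr (by positivity))

lemma bm_ball {N : ℕ} (hN : 1 ≤ N) {K L : Set (Euc N)} (hK : MeasurableSet K)
    (hL : MeasurableSet L) (hne : K.Nonempty) {a t : ℝ} (ha : 0 ≤ a) (ht : 0 < t)
    (hKv : ENNReal.ofReal (om N * a ^ N) ≤ volume K)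
    (h : ∀ x ∈ K, ∀ y, dist y x < t → y ∈ L) :
    ENNReal.ofReal (om N * (a + t) ^ N) ≤ volume L := by
  rcases ha.eq_or_lt with rfl | ha
  · obtain ⟨x, hx⟩ := hne
    rw [zero_add, ← vol_ball hN x ht.le]
    exact measure_mono fun y hy => h x hx y hy
  have hat : 0 < a + t := by linarith
  set l := t / (a + t) with hl
  have h0 : 0 < l := by positivity
  have h1 : l < 1 := by rw [hl, div_lt_one hat]; linarith
  have h1' : 0 < 1 - l := by linarith
  have e1 : 1 - l = a / (a + t) := by rw [hl]; field_simp; ring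
  set K' : Set (Euc N) := (fun x => (1 - l) • x) ⁻¹' K with hK'
  have mK' : MeasurableSet K' := hK.preimage (by fun_prop)
  have vK' : ENNReal.ofReal (om N * (a + t) ^ N) ≤ volume K' := by
    rw [hK', Measure.addHaar_preimage_smul _ h1'.ne', finrank_euclideanSpace, Fintype.card_fin]
    calc ENNReal.ofReal (om N * (a + t) ^ N)
        = ENNReal.ofReal |((1 - l) ^ N)⁻¹| * ENNReal.ofReal (om N * a ^ N) := by
          rw [← ENNReal.ofReal_mul (abs_nonneg _), abs_of_pos (by positivity)]
          congr 1
          rw [e1, div_pow]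
          have := ha.ne'
          field_simp
      _ ≤ _ := by gcongr
  have := pl_euc (f := K'.indicator 1) (g := (ball (0 : Euc N) (a + t)).indicator 1)
    (h := L.indicator 1) (measurable_one.indicator mK') (measurable_one.indicator measurableSet_ball)
    (measurable_one.indicator hL) h0 h1 (by
      intro x y
      by_cases hx : x ∈ K'
      · by_cases hy : y ∈ ball (0 : Euc N) (a + t)
        · have : (1 - l) • x + l • y ∈ L := by
            refine h _ hx _ ?_
            rw [dist_eq_norm, add_sub_cancel_left, norm_smul, Real.norm_of_nonneg h0.le, hl]
            rw [mem_ball_zero_iff] at hy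
            calc t / (a + t) * ‖y‖ < t / (a + t) * (a + t) := by gcongr
              _ = t := by field_simp
          simp [hx, hy, this]
        · simp [hy, h0]
      · simp [hx, h1'])
  rw [lintegral_indicator_one mK', lintegral_indicator_one measurableSet_ball,
    lintegral_indicator_one hL, vol_ball hN _ hat.le] at this
  refine le_trans ?_ this
  calc ENNReal.ofReal (om N * (a + t) ^ N) = ENNReal.ofReal (om N * (a + t) ^ N) ^ (1 - l) *
        ENNReal.ofReal (om N * (a + t) ^ N) ^ l := by
        have := om_pos N
        rw [← ENNReal.rpow_add _ _ (by simp only [ne_eq, ofReal_eq_zero, not_le]; positivity) ofReal_ne_top]; simp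
    _ ≤ _ := by gcongr

end

section

/-- the inverse distribution function of an antitone function. -/
def starF (F : ℝ → ℝ≥0∞) (v : ℝ) : ℝ≥0∞ := volume (Ioi (0:ℝ) ∩ {s | ENNReal.ofReal v < F s})

lemma starF_le {F : ℝ → ℝ≥0∞} (hF : Antitone F) {v s : ℝ} (h : F s ≤ ENNReal.ofReal v) :
    starF F v ≤ ENNReal.ofReal s := by
  have : Ioi (0:ℝ) ∩ {s | ENNReal.ofReal v < F s} ⊆ Ioo 0 s := by
    rintro x ⟨hx0, hx⟩
    refine ⟨hx0, ?_⟩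
    by_contra! hc
    exact absurd (lt_of_lt_of_le hx (hF hc)) (not_lt.2 h)
  refine (measure_mono this).trans ?_
  simp

lemma le_starF {F : ℝ → ℝ≥0∞} (hF : Antitone F) {v s : ℝ} (h : ENNReal.ofReal v < F s) :
    ENNReal.ofReal s ≤ starF F v := by
  have : Ioc 0 s ⊆ Ioi (0:ℝ) ∩ {s | ENNReal.ofReal v < F s} := by
    rintro x ⟨hx0, hx⟩
    exact ⟨hx0, lt_of_lt_of_le h (hF hx)⟩
  refine le_trans ?_ (measure_mono this)
  simp

lemma lt_of_starF {F : ℝ → ℝ≥0∞} (hF : Antitone F) {v s : ℝ} (h : ENNReal.ofReal s < starF F v) :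
    ENNReal.ofReal v < F s := by
  by_contra! hc
  exact absurd h (not_lt.2 (starF_le hF hc))

lemma le_of_starF {F : ℝ → ℝ≥0∞} (hF : Antitone F) {v s : ℝ} (h : starF F v < ENNReal.ofReal s) :
    F s ≤ ENNReal.ofReal v := by
  by_contra! hc
  exact absurd h (not_lt.2 (le_starF hF hc))

lemma starF_anti (F : ℝ → ℝ≥0∞) : Antitone (starF F) := by
  intro v w h
  apply measure_mono
  rintro s ⟨h1, h2⟩
  exact ⟨h1, lt_of_le_of_lt (ofReal_le_ofReal h) h2⟩

lemma tonelli_star {F : ℝ → ℝ≥0∞} (hF : Antitone F) (m c : ℝ) :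
    ∫⁻ s in Ioi (0:ℝ), volume (Ioo 0 m ∩ {v | ENNReal.ofReal (c + v) < F s})
      = ∫⁻ v in Ioo 0 m, starF F (c + v) := by
  have hm : MeasurableSet {z : ℝ × ℝ | ENNReal.ofReal (c + z.2) < F z.1} := by
    have := hF.measurable
    exact measurableSet_lt (by fun_prop) (by fun_prop)
  have h1 := Measure.prod_apply (μ := volume.restrict (Ioi (0:ℝ))) (ν := volume.restrict (Ioo 0 m)) hm
  have h2 := Measure.prod_apply_symm (μ := volume.restrict (Ioi (0:ℝ))) (ν := volume.restrict (Ioo 0 m)) hm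
  rw [h1] at h2
  convert h2 using 1
  · refine lintegral_congr fun s => ?_
    rw [Measure.restrict_apply (hm.preimage measurable_prodMk_left), inter_comm]
    rfl
  · refine lintegral_congr fun s => ?_
    rw [Measure.restrict_apply (hm.preimage measurable_prodMk_right), inter_comm]
    rfl

lemma layer_vol (m : ℝ) (F : ℝ≥0∞) (hm : 0 < m) :
    min F (ENNReal.ofReal m) ≤ volume (Ioo 0 m ∩ {v | ENNReal.ofReal (0 + v) < F}) := by
  rcases le_or_gt (ENNReal.ofReal m) F with h | h
  · have : Ioo 0 m ⊆ Ioo 0 m ∩ {v | ENNReal.ofReal (0 + v) < F} := by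
      intro v hv
      refine ⟨hv, lt_of_lt_of_le ?_ h⟩
      rw [zero_add]
      exact (ofReal_lt_ofReal_iff hm).2 hv.2
    refine le_trans ?_ (measure_mono this)
    simp [h]
  · have hF : F ≠ ⊤ := ne_top_of_lt h
    have : Ioo 0 F.toReal ⊆ Ioo 0 m ∩ {v | ENNReal.ofReal (0 + v) < F} := by
      intro v hv
      refine ⟨⟨hv.1, hv.2.trans ?_⟩, ?_⟩
      · rw [← ENNReal.toReal_ofReal hm.le]; exact (toReal_lt_toReal hF ofReal_ne_top).2 h
      · rw [mem_ofPred_eq, zero_add]; exact (ENNReal.ofReal_lt_iff_lt_toReal hv.1.le hF).2 hv.2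
    refine le_trans ?_ (measure_mono this)
    simp [hF]

lemma layer_vol' {m : ℝ} (hm : 0 < m) (F : ℝ≥0∞) {n : ℝ≥0∞} (h : F ≤ ENNReal.ofReal m + n) :
    volume (Ioo 0 m ∩ {v | ENNReal.ofReal (m + v) < F}) ≤ n := by
  rcases eq_or_ne n ⊤ with rfl | hn
  · simp
  have : Ioo 0 m ∩ {v | ENNReal.ofReal (m + v) < F} ⊆ Ioo 0 n.toReal := by
    rintro v ⟨hv, hv2⟩
    refine ⟨hv.1, ?_⟩
    have := lt_of_lt_of_le hv2 h
    rw [ENNReal.ofReal_add hm.le hv.1.le, ENNReal.add_lt_add_iff_left ofReal_ne_top] at this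
    exact (ENNReal.ofReal_lt_iff_lt_toReal hv.1.le hn).1 this
  refine (measure_mono this).trans ?_
  simp [hn]

lemma gain_lint {f g : ℝ → ℝ≥0∞} {A : Set ℝ} {a b : ℝ} {c : ℝ≥0∞} (hA : MeasurableSet A)
    (hf : Measurable f)
    (hI : Ioo a b ⊆ A) (h : ∀ x ∈ A, f x ≤ g x) (h' : ∀ x ∈ Ioo a b, f x + c ≤ g x) :
    (∫⁻ x in A, f x) + c * ENNReal.ofReal (b - a) ≤ ∫⁻ x in A, g x := by
  have e : c * ENNReal.ofReal (b - a) = ∫⁻ x in A, (Ioo a b).indicator (fun _ => c) x := by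
    rw [lintegral_indicator measurableSet_Ioo, lintegral_const, Measure.restrict_apply_univ,
      Measure.restrict_apply measurableSet_Ioo, inter_eq_left.2 hI, Real.volume_Ioo]
  rw [e, ← lintegral_add_left hf]
  refine setLIntegral_mono' hA fun x hx => ?_
  by_cases hxI : x ∈ Ioo a b
  · simpa [hxI] using h' x hxI
  · simpa [hxI] using h x hx

variable {N : ℕ}

/-- distribution function. -/
def dF (φ : Euc N → ℝ) (s : ℝ) : ℝ≥0∞ := volume {x | s < φ x}

lemma dF_anti (φ : Euc N → ℝ) : Antitone (dF φ) := fun _ _ h =>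
  measure_mono fun _ hx => lt_of_le_of_lt h hx

lemma claimA {φ : Euc N → ℝ} (hφ : Measurable φ) (h0 : ∀ x, 0 ≤ φ x) {μ ν : Measure (Euc N)}
    (hμν : μ + ν = volume) {m : ℝ} (hm : 0 < m) (hμ : μ univ = ENNReal.ofReal m) :
    ∫⁻ x, ENNReal.ofReal (φ x) ∂μ ≤ ∫⁻ v in Ioo 0 m, starF (dF φ) v := by
  have := tonelli_star (dF_anti φ) m 0
  simp only [zero_add] at this
  rw [← this, lintegral_eq_lintegral_meas_lt μ (ae_of_all _ h0) hφ.aemeasurable]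
  refine lintegral_mono fun s => ?_
  have hl := layer_vol m (dF φ s) hm
  simp only [zero_add] at hl
  refine le_trans ?_ hl
  refine le_min ?_ (hμ ▸ measure_mono (subset_univ _))
  rw [dF, ← hμν]; simp

lemma claimB_pt {ψ : Euc N → ℝ} {μ ν : Measure (Euc N)}
    (hμν : μ + ν = volume) {m : ℝ} (hm : 0 < m) (hμ : μ univ = ENNReal.ofReal m) (s : ℝ) :
    volume (Ioo 0 m ∩ {v | ENNReal.ofReal (m + v) < dF ψ s}) ≤ ν {x | s < ψ x} := by
  apply layer_vol' hm
  rw [dF, ← hμν, Measure.add_apply]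
  gcongr
  exact hμ ▸ measure_mono (subset_univ _)

lemma meas_layer {F : ℝ → ℝ≥0∞} (hF : Antitone F) (m : ℝ) :
    Measurable fun s => volume (Ioo 0 m ∩ {v | ENNReal.ofReal (m + v) < F s}) := by
  apply Antitone.measurable
  intro s t h
  apply measure_mono
  rintro v ⟨h1, h2⟩
  exact ⟨h1, lt_of_lt_of_le h2 (hF h)⟩

lemma claimB {ψ : Euc N → ℝ} (hψ : Measurable ψ) (h0 : ∀ x, 0 ≤ ψ x) {μ ν : Measure (Euc N)}
    (hμν : μ + ν = volume) {m : ℝ} (hm : 0 < m) (hμ : μ univ = ENNReal.ofReal m) :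
    ∫⁻ v in Ioo 0 m, starF (dF ψ) (m + v) ≤ ∫⁻ x, ENNReal.ofReal (ψ x) ∂ν := by
  rw [← tonelli_star (dF_anti ψ) m m, lintegral_eq_lintegral_meas_lt ν (ae_of_all _ h0) hψ.aemeasurable]
  exact lintegral_mono fun s => claimB_pt hμν hm hμ s

lemma claimC (hN : 1 ≤ N) {φ ψ : Euc N → ℝ} (hφ : Measurable φ) (hψ : Measurable ψ)
    {M : ℝ} (hφM : ∀ x, φ x ≤ M) (hψ0 : ∀ x, 0 ≤ ψ x) (hψM : ∀ x, ψ x ≤ M) {p κ T : ℝ} (hp : 1 < p)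
    (hκ : 0 < κ)
    (hd : ∀ x y, 0 < φ x → dist y x < T → φ x ≤ ψ y + (dist y x + κ) ^ p)
    {u w : ℝ} (hu : 0 ≤ u) (huw : u < w) (hT : rad N w < T) :
    starF (dF φ) u ≤ starF (dF ψ) w + ENNReal.ofReal ((rad N w - rad N u + κ) ^ p) := by
  have hle := rad_lt hN hu huw
  have hra := rad_nonneg (N := N) hu
  have fin : ∀ {φ : Euc N → ℝ}, (∀ x, φ x ≤ M) → ∀ {u : ℝ}, starF (dF φ) u ≠ ⊤ := by
    intro φ h u
    refine ne_top_of_le_ne_top ofReal_ne_top (starF_le (dF_anti φ) (s := M) ?_)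
    have : {x | M < φ x} = ∅ := by ext x; simpa using h x
    simp [dF, this]
  by_contra! hc
  rw [← ofReal_toReal (fin hψM (u := w)), ← ofReal_toReal (fin hφM (u := u)),
    ← ENNReal.ofReal_add toReal_nonneg (by
      apply Real.rpow_nonneg; linarith), ofReal_lt_ofReal_iff_of_nonneg (by
      have : 0 ≤ (rad N w - rad N u + κ) ^ p := by apply Real.rpow_nonneg; linarith
      positivity)] at hc
  set S := (starF (dF ψ) w).toReal with hS
  set P := (starF (dF φ) u).toReal with hP
  have hS0 : 0 ≤ S := toReal_nonneg
  have hcont : Tendsto (fun ε : ℝ => S + ε + (rad N w - rad N u + ε + κ) ^ p) (nhdsWithin 0 (Ioi 0))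
      (nhds (S + 0 + (rad N w - rad N u + 0 + κ) ^ p)) := by
    apply tendsto_nhdsWithin_of_tendsto_nhds
    apply ContinuousAt.tendsto
    apply ContinuousAt.add (by fun_prop)
    apply ContinuousAt.rpow_const (by fun_prop) (Or.inr (by linarith))
  have hTa : ∀ᶠ ε : ℝ in nhdsWithin 0 (Ioi 0), rad N w - rad N u + ε < T := by
    have : Tendsto (fun ε : ℝ => rad N w - rad N u + ε) (nhdsWithin 0 (Ioi 0)) (nhds (rad N w - rad N u + 0)) := by
      apply tendsto_nhdsWithin_of_tendsto_nhds
      apply ContinuousAt.tendsto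
      fun_prop
    exact this.eventually_lt_const (by linarith)
  have hev := hcont.eventually_lt_const (u := P) (by simpa using hc)
  obtain ⟨ε, ⟨h1, h2⟩, hε⟩ := ((hev.and hTa).and self_mem_nhdsWithin).exists
  set t := rad N w - rad N u + ε with ht
  have htp : 0 < t := by linarith
  have hpw : 0 ≤ (t + κ) ^ p := by positivity
  have hK : ENNReal.ofReal u < dF φ (S + ε + (t + κ) ^ p) := by
    apply lt_of_starF (dF_anti φ)
    rw [← ofReal_toReal (fin hφM (u := u))]
    exact (ofReal_lt_ofReal_iff_of_nonneg (by positivity)).2 h1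
  have hL : dF ψ (S + ε) ≤ ENNReal.ofReal w := by
    apply le_of_starF (dF_anti ψ)
    rw [← ofReal_toReal (fin hψM (u := w))]
    exact (ofReal_lt_ofReal_iff_of_nonneg (by positivity)).2 (by linarith)
  have := bm_ball hN (K := {x | S + ε + (t + κ) ^ p < φ x}) (L := {x | S + ε < ψ x})
    (measurableSet_lt measurable_const hφ) (measurableSet_lt measurable_const hψ)
    (by
      by_contra hne
      rw [not_nonempty_iff_eq_empty] at hne
      simp [dF, hne] at hK) hra htp (by rw [rad_pow hN hu]; exact hK.le)
    (by
      intro x hx y hy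
      simp only [mem_ofPred_eq] at hx ⊢
      have h3 := hd x y (by linarith) (hy.trans h2)
      have : (dist y x + κ) ^ p ≤ (t + κ) ^ p := by
        apply Real.rpow_le_rpow <;> [positivity; linarith; linarith]
      linarith)
  have h4 := this.trans hL
  rw [ofReal_le_ofReal_iff (by linarith)] at h4
  have h5 : om N * rad N w ^ N < om N * (rad N u + t) ^ N := by
    have := om_pos N
    have : 0 ≤ rad N w := by linarith
    have h6 : rad N w < rad N u + t := by linarith
    have : N ≠ 0 := by omega
    gcongr
  rw [rad_pow hN (by linarith)] at h5
  linarith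

end

section

variable {N : ℕ}

/-- The value `V_κ`. -/
def Vk (N : ℕ) (p m κ : ℝ) : ℝ≥0∞ :=
  ∫⁻ v in Ioo 0 m, ENNReal.ofReal ((rad N (m + v) - rad N v + κ) ^ p)

lemma starF_fin {φ : Euc N → ℝ} {M : ℝ} (h : ∀ x, φ x ≤ M) (u : ℝ) : starF (dF φ) u ≠ ⊤ := by
  refine ne_top_of_le_ne_top ofReal_ne_top (starF_le (dF_anti φ) (s := M) ?_)
  have : {x | M < φ x} = ∅ := by ext x; simpa using h x
  simp [dF, this]

lemma meas_C (N : ℕ) (p m κ : ℝ) (hp : 1 < p) :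
    Measurable fun v => ENNReal.ofReal ((rad N (m + v) - rad N v + κ) ^ p) := by
  have := rad_cont N
  refine (Continuous.measurable ?_).ennreal_ofReal
  refine Continuous.rpow_const (by fun_prop) (fun x => Or.inr (by linarith))

lemma dual_bound (hN : 1 ≤ N) {φ ψ : Euc N → ℝ} (hφ : Measurable φ) (hψ : Measurable ψ)
    {M : ℝ} (hφ0 : ∀ x, 0 ≤ φ x) (hφM : ∀ x, φ x ≤ M) (hψ0 : ∀ x, 0 ≤ ψ x) (hψM : ∀ x, ψ x ≤ M)
    {p κ T m : ℝ} (hp : 1 < p) (hκ : 0 < κ)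
    (hd : ∀ x y, 0 < φ x → dist y x < T → φ x ≤ ψ y + (dist y x + κ) ^ p)
    (hm : 0 < m) (hT : rad N (2 * m) < T) {μ ν : Measure (Euc N)}
    (hμν : μ + ν = volume) (hμ : μ univ = ENNReal.ofReal m) :
    ∫⁻ x, ENNReal.ofReal (φ x) ∂μ ≤ ∫⁻ x, ENNReal.ofReal (ψ x) ∂ν + Vk N p m κ := by
  calc ∫⁻ x, ENNReal.ofReal (φ x) ∂μ ≤ ∫⁻ v in Ioo 0 m, starF (dF φ) v :=
        claimA hφ hφ0 hμν hm hμ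
    _ ≤ ∫⁻ v in Ioo 0 m, (starF (dF ψ) (m + v) + ENNReal.ofReal ((rad N (m + v) - rad N v + κ) ^ p)) := by
        refine setLIntegral_mono' measurableSet_Ioo fun v hv => ?_
        refine claimC hN hφ hψ hφM hψ0 hψM hp hκ hd hv.1.le (by linarith) (lt_of_le_of_lt ?_ hT)
        exact rad_le (by linarith [hv.1]) (by linarith [hv.2])
    _ = _ := lintegral_add_right _ (meas_C N p m κ hp)
    _ ≤ _ := by unfold Vk; gcongr; exact claimB hψ hψ0 hμν hm hμ

lemma dual_bound_strict (hN : 1 ≤ N) {p m η : ℝ} (hp : 1 < p) (hm : 0 < m) (hη : 0 < η)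
    (hηm : η ≤ m) {μ ν : Measure (Euc N)}
    (hμν : μ + ν = volume) (hμ : μ univ = ENNReal.ofReal m)
    (hball : ∀ x, μ (ball x (rad N m)) ≤ ENNReal.ofReal (m - η)) :
    ∃ δ : ℝ, 0 < δ ∧ ∀ (φ ψ : Euc N → ℝ) (M κ T : ℝ), Measurable φ → Measurable ψ →
      (∀ x, 0 ≤ φ x) → (∀ x, φ x ≤ M) → (∀ x, 0 ≤ ψ x) → (∀ x, ψ x ≤ M) → 0 < κ →
      (∀ x y, 0 < φ x → dist y x < T → φ x ≤ ψ y + (dist y x + κ) ^ p) →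
      rad N (2 * m) < T →
    ∫⁻ x, ENNReal.ofReal (φ x) ∂μ + ENNReal.ofReal δ ≤
      ∫⁻ x, ENNReal.ofReal (ψ x) ∂ν + Vk N p m κ := by
  have hom := om_pos N
  set v2 := η / 8 with hv2
  set t0 := rad N (m - η / 4) with ht0
  set g := rad N m - t0 with hg
  have hgp : 0 < g := by
    have := rad_lt hN (v := m - η/4) (w := m) (by linarith) (by linarith)
    linarith
  have ht0p : 0 < t0 := by
    have := rad_lt hN (v := 0) (w := m - η/4) le_rfl (by linarith)
    rwa [rad_zero hN] at this
  set v1 := min (v2 / 2) (om N * (g / 2) ^ N) / 2 with hv1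
  have hv1p : 0 < v1 := by positivity
  have hv1a : 2 * v1 ≤ v2 / 2 := by
    have := min_le_left (v2 / 2) (om N * (g / 2) ^ N)
    linarith
  have hv1b : rad N (2 * v1) ≤ g / 2 := by
    rw [← rad_of_pow hN (s := g / 2) (by positivity)]
    apply rad_le (by positivity)
    have := min_le_right (v2 / 2) (om N * (g / 2) ^ N)
    linarith
  have hv2p : 0 < v2 := by positivity
  set γ := (rad N (m + v2) - rad N (m + 2 * v1)) ^ p with hγ
  have hγd : 0 < rad N (m + v2) - rad N (m + 2 * v1) := by
    have := rad_lt hN (v := m + 2 * v1) (w := m + v2) (by linarith) (by linarith)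
    linarith
  have hγp : 0 < γ := by positivity
  set θ := (g / 2) ^ p with hθ
  have hθp : 0 < θ := by positivity
  set δ := min (v1 * θ / 2) (min (v2 * γ / 2) (γ * η / 8)) with hδ
  have hδp : 0 < δ := by positivity
  have hδ1 : δ / v1 ≤ θ / 2 := by
    rw [div_le_iff₀ hv1p]
    have := min_le_left (v1 * θ / 2) (min (v2 * γ / 2) (γ * η / 8))
    linarith
  have hδ2 : δ / v2 ≤ γ / 2 := by
    rw [div_le_iff₀ hv2p]
    have := (min_le_right (v1 * θ / 2) (min (v2 * γ / 2) (γ * η / 8))).trans (min_le_left _ _)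
    linarith
  have hδ3 : δ ≤ γ * η / 8 :=
    (min_le_right (v1 * θ / 2) (min (v2 * γ / 2) (γ * η / 8))).trans (min_le_right _ _)
  refine ⟨δ, hδp, ?_⟩
  intro φ ψ M κ T hφ hψ hφ0 hφM hψ0 hψM hκ hd hT
  by_contra! hcon
  set P := starF (dF φ) with hP
  set S := fun v => starF (dF ψ) (m + v) with hS
  set C := fun v => ENNReal.ofReal ((rad N (m + v) - rad N v + κ) ^ p) with hC
  have hA := claimA hφ hφ0 hμν hm hμ
  have hB := claimB hψ hψ0 hμν hm hμ
  have hPm : Measurable P := (starF_anti _).measurable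
  have hPC : ∀ v ∈ Ioo 0 m, P v ≤ S v + C v := by
    intro v hv
    refine claimC hN hφ hψ hφM hψ0 hψM hp hκ hd hv.1.le (by linarith) (lt_of_le_of_lt ?_ hT)
    exact rad_le (by linarith [hv.1]) (by linarith [hv.2])
  have hPfin : ∫⁻ v in Ioo 0 m, P v ≠ ⊤ := by
    have : ∫⁻ v in Ioo 0 m, P v ≤ ∫⁻ v in Ioo 0 m, ENNReal.ofReal M := by
      refine lintegral_mono fun v => starF_le (dF_anti φ) (s := M) ?_
      have : {x | M < φ x} = ∅ := by ext x; simpa using hφM x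
      simp [dF, this]
    refine ne_top_of_le_ne_top ?_ this
    simp [ENNReal.mul_eq_top]
  have hSC : ∫⁻ v in Ioo 0 m, (S v + C v) = (∫⁻ v in Ioo 0 m, S v) + Vk N p m κ :=
    lintegral_add_right _ (meas_C N p m κ hp)
  -- main strict inequality
  have main : ∫⁻ x, ENNReal.ofReal (ψ x) ∂ν + Vk N p m κ < (∫⁻ v in Ioo 0 m, P v) + ENNReal.ofReal δ :=
    lt_of_lt_of_le hcon (by gcongr)
  have pick : ∀ c : ℝ, 0 < c → 2 * c ≤ m → ∃ v ∈ Ioo c (2 * c), S v + C v < P v + ENNReal.ofReal (δ / c) := by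
    intro c hc hcm
    by_contra! hn
    have := gain_lint (f := P) (g := fun v => S v + C v) (A := Ioo 0 m) (a := c) (b := 2 * c)
      (c := ENNReal.ofReal (δ / c)) measurableSet_Ioo hPm (Ioo_subset_Ioo hc.le hcm) hPC hn
    rw [← ENNReal.ofReal_mul (by positivity), show δ / c * (2 * c - c) = δ by field_simp; ring, hSC] at this
    exact absurd (main.trans_le (this.trans (by gcongr))) (lt_irrefl _)
  obtain ⟨v, hv, hve⟩ := pick v1 hv1p (by linarith)
  obtain ⟨w, hw, hwe⟩ := pick v2 hv2p (by linarith)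
  have toR : ∀ {c v}, 0 ≤ v → S v + C v < P v + ENNReal.ofReal c → 0 ≤ c →
      (S v).toReal + (rad N (m + v) - rad N v + κ) ^ p < (P v).toReal + c := by
    intro c v hv h hc
    have h1 : 0 ≤ (rad N (m + v) - rad N v + κ) ^ p := by
      have := rad_le (N := N) hv (show v ≤ m + v by linarith)
      apply Real.rpow_nonneg; linarith
    have hSv : S v ≠ ⊤ := starF_fin hψM _
    have hPv : P v ≠ ⊤ := starF_fin hφM _
    have hCv : C v = ENNReal.ofReal ((rad N (m + v) - rad N v + κ) ^ p) := rfl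
    rw [← ofReal_toReal hSv, ← ofReal_toReal hPv,
      hCv, ← ENNReal.ofReal_add toReal_nonneg h1, ← ENNReal.ofReal_add toReal_nonneg hc,
      ofReal_lt_ofReal_iff_of_nonneg (by positivity)] at h
    exact h
  have rv := toR (by linarith [hv.1]) hve (by positivity)
  have rw' := toR (by linarith [hw.1]) hwe (by positivity)
  set s1 := (S v).toReal with hs1
  set s2 := (S w).toReal with hs2
  have hs10 : 0 ≤ s1 := toReal_nonneg
  have hs20 : 0 ≤ s2 := toReal_nonneg
  have hradm : 0 ≤ rad N m := rad_nonneg hm.le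
  -- gap
  have gap : γ / 2 ≤ s1 - s2 := by
    have h1 := claimC hN hφ hψ hφM hψ0 hψM hp hκ hd (u := w) (w := m + v) (by linarith [hw.1])
      (by linarith [hw.2, hv.1]) (lt_of_le_of_lt (rad_le (by linarith [hv.1]) (by linarith [hv.2])) hT)
    have h2 := rad_le (N := N) (v := w) (w := m + v) (by linarith [hw.1]) (by linarith [hw.2, hv.1])
    have h3 : 0 ≤ (rad N (m + v) - rad N w + κ) ^ p := by
      apply Real.rpow_nonneg; linarith
    rw [← ofReal_toReal (starF_fin hψM _), ← ofReal_toReal (starF_fin hφM _),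
      ← ENNReal.ofReal_add toReal_nonneg h3, ofReal_le_ofReal_iff (by positivity)] at h1
    have h4 : γ + (rad N (m + v) - rad N w + κ) ^ p ≤ (rad N (m + w) - rad N w + κ) ^ p := by
      have a1 := rad_le (N := N) (v := m + v2) (w := m + w) (by linarith) (by linarith [hw.1])
      have a2 := rad_le (N := N) (v := m + v) (w := m + 2 * v1) (by linarith [hv.1]) (by linarith [hv.2])
      refine (Real.add_rpow_le_rpow_add hγd.le (by linarith) hp.le).trans ?_
      apply Real.rpow_le_rpow <;> linarith
    change (P w).toReal ≤ s1 + _ at h1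
    linarith
  -- ball
  have hball2 : ∃ x0, ball x0 t0 ⊆ {y | s1 < ψ y} := by
    have a1 := rad_le (N := N) (v := m) (w := m + v) (by linarith) (by linarith [hv.1])
    have a2 := rad_le (N := N) (v := v) (w := 2 * v1) (by linarith [hv.1]) (by linarith [hv.2])
    have a3 : θ + (t0 + κ) ^ p ≤ (rad N (m + v) - rad N v + κ) ^ p := by
      refine (Real.add_rpow_le_rpow_add (by positivity) (by positivity) hp.le).trans ?_
      apply Real.rpow_le_rpow
      · positivity
      · linarith
      · linarith
    have a4 : s1 + (t0 + κ) ^ p < (P v).toReal := by linarith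
    have a5 : ENNReal.ofReal v < dF φ (s1 + (t0 + κ) ^ p) := by
      apply lt_of_starF (dF_anti φ)
      rw [← ofReal_toReal (starF_fin hφM v)]
      exact (ofReal_lt_ofReal_iff_of_nonneg (by positivity)).2 a4
    have : {x | s1 + (t0 + κ) ^ p < φ x}.Nonempty := by
      by_contra hne
      rw [not_nonempty_iff_eq_empty] at hne
      simp [dF, hne] at a5
    obtain ⟨x0, hx0⟩ := this
    rw [mem_ofPred_eq] at hx0
    refine ⟨x0, fun y hy => ?_⟩
    rw [mem_ball] at hy
    have b1 : 0 < (t0 + κ) ^ p := by positivity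
    have b2 : t0 < T := by
      have := rad_le (N := N) (v := m) (w := 2 * m) hm.le (by linarith)
      linarith
    have b3 := hd x0 y (by linarith) (hy.trans b2)
    have b4 : (dist y x0 + κ) ^ p ≤ (t0 + κ) ^ p := by
      apply Real.rpow_le_rpow <;> [positivity; linarith; linarith]
    rw [mem_ofPred_eq]
    linarith
  obtain ⟨x0, hx0⟩ := hball2
  have hνb : ENNReal.ofReal (3 / 4 * η) ≤ ν (ball x0 t0) := by
    have h1 : volume (ball x0 t0) = ENNReal.ofReal (m - η / 4) := vol_ball_rad hN _ (by linarith)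
    rw [← hμν, Measure.add_apply] at h1
    have h2 : μ (ball x0 t0) ≤ ENNReal.ofReal (m - η) :=
      (measure_mono (ball_subset_ball (by linarith))).trans (hball x0)
    have h3 : ENNReal.ofReal (m - η) + ENNReal.ofReal (3 / 4 * η) ≤ ENNReal.ofReal (m - η) + ν (ball x0 t0) := by
      rw [← ENNReal.ofReal_add (by linarith) (by positivity)]
      rw [show m - η + 3 / 4 * η = m - η / 4 by ring, ← h1]
      gcongr
    exact (ENNReal.add_le_add_iff_left ofReal_ne_top).1 h3
  have hgain := gain_lint (f := fun s => volume (Ioo 0 m ∩ {v | ENNReal.ofReal (m + v) < dF ψ s}))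
    (g := fun s => ν {x | s < ψ x}) (A := Ioi 0) (a := s2) (b := s1)
      (c := ENNReal.ofReal (η / 2)) measurableSet_Ioi (meas_layer (dF_anti ψ) m)
      (fun s hs => lt_of_le_of_lt hs20 hs.1) (fun s _ => claimB_pt hμν hm hμ s) (by
        intro s hs
        have h1 : dF ψ s ≤ ENNReal.ofReal (m + w) := by
          apply le_of_starF (dF_anti ψ)
          rw [← ofReal_toReal (starF_fin hψM _)]
          exact (ofReal_lt_ofReal_iff_of_nonneg hs20).2 hs.1
        rw [ENNReal.ofReal_add hm.le (by linarith [hw.1])] at h1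
        have h2 := layer_vol' hm _ h1
        calc _ ≤ ENNReal.ofReal w + ENNReal.ofReal (η / 2) := by gcongr
          _ = ENNReal.ofReal (w + η / 2) := (ENNReal.ofReal_add (by linarith [hw.1]) (by positivity)).symm
          _ ≤ ENNReal.ofReal (3 / 4 * η) := ofReal_le_ofReal (by linarith [hw.2])
          _ ≤ _ := hνb
          _ ≤ _ := measure_mono (hx0.trans fun y hy => lt_trans hs.2 hy))
  rw [tonelli_star (dF_anti ψ) m m, ← lintegral_eq_lintegral_meas_lt ν (ae_of_all _ hψ0) hψ.aemeasurable] at hgain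
  have hδg : ENNReal.ofReal δ ≤ ENNReal.ofReal (η / 2) * ENNReal.ofReal (s1 - s2) := by
    rw [← ENNReal.ofReal_mul (by positivity)]
    apply ofReal_le_ofReal
    have : η / 2 * (γ / 2) ≤ η / 2 * (s1 - s2) := by gcongr
    have : 0 < γ * η := by positivity
    linarith
  have fin1 : (∫⁻ v in Ioo 0 m, P v) + ENNReal.ofReal δ ≤ ∫⁻ x, ENNReal.ofReal (ψ x) ∂ν + Vk N p m κ := by
    calc (∫⁻ v in Ioo 0 m, P v) + ENNReal.ofReal δ ≤ (∫⁻ v in Ioo 0 m, (S v + C v)) + ENNReal.ofReal (η / 2) * ENNReal.ofReal (s1 - s2) := by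
          exact add_le_add (setLIntegral_mono' measurableSet_Ioo hPC) hδg
      _ = ((∫⁻ v in Ioo 0 m, S v) + ENNReal.ofReal (η / 2) * ENNReal.ofReal (s1 - s2)) + Vk N p m κ := by
          rw [hSC]; ring
      _ ≤ _ := by gcongr
  exact absurd (main.trans_le fin1) (lt_irrefl _)

end

section

open scoped Pointwise in
lemma lp_duality {I J : Type} [Fintype I] [Fintype J] [Nonempty J] (a : I → ℝ) (b : J → ℝ) (c : I → J → ℝ) (V : ℝ)
    (ha : ∀ i, 0 ≤ a i) (hc : ∀ i j, 0 ≤ c i j)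
    (h : ∀ (φ : I → ℝ) (ψ : J → ℝ), (∀ j, 0 ≤ ψ j) → (∀ i j, φ i - ψ j ≤ c i j) →
      ∑ i, φ i * a i ≤ ∑ j, ψ j * b j + V) :
    ∃ q : I → J → ℝ, (∀ i j, 0 ≤ q i j) ∧ (∀ i, ∑ j, q i j = a i) ∧ (∀ j, ∑ i, q i j ≤ b j) ∧
      ∑ i, ∑ j, c i j * q i j ≤ V := by
  classical
  set K : Set (I → J → ℝ) := {q | (∀ i j, 0 ≤ q i j) ∧ ∀ i, ∑ j, q i j = a i} with hK
  set Lm : (I → J → ℝ) → (J → ℝ) × ℝ := fun q => (fun j => ∑ i, q i j, ∑ i, ∑ j, c i j * q i j) with hL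
  have hLc : Continuous Lm := by rw [hL]; fun_prop
  have hKc : IsCompact K := by
    apply IsCompact.of_isClosed_subset (isCompact_univ_pi fun i => isCompact_univ_pi fun _ : J => isCompact_Icc (a := 0) (b := a i))
    · rw [hK]
      refine IsClosed.and ?_ ?_
      · simp only [setOf_forall]
        exact isClosed_iInter fun i => isClosed_iInter fun j => isClosed_le continuous_const (by fun_prop)
      · simp only [setOf_forall]
        exact isClosed_iInter fun i => isClosed_eq (by fun_prop) continuous_const
    · rintro q ⟨h1, h2⟩ i - j -
      exact ⟨h1 i j, by rw [← h2 i]; exact Finset.single_le_sum (f := fun j => q i j) (fun j _ => h1 i j) (Finset.mem_univ j)⟩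
  have hKconv : Convex ℝ K := by
    rintro q ⟨h1, h2⟩ q' ⟨h1', h2'⟩ s t hs ht hst
    refine ⟨fun i j => ?_, fun i => ?_⟩
    · have := h1 i j
      have := h1' i j
      simp only [Pi.add_apply, Pi.smul_apply, smul_eq_mul]
      positivity
    · simp only [Pi.add_apply, Pi.smul_apply, smul_eq_mul, Finset.sum_add_distrib, ← Finset.mul_sum, h2, h2']
      rw [← add_mul, hst, one_mul]
  by_contra hcon
  have hS : ((b, V) : (J → ℝ) × ℝ) ∉ Lm '' K + Ici 0 := by
    rintro ⟨_, ⟨q, hq, rfl⟩, s, hs, he⟩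
    apply hcon
    have e1 := congrArg Prod.fst he
    have e2 := congrArg Prod.snd he
    simp only [hL, Prod.fst_add, Prod.snd_add] at e1 e2
    refine ⟨q, hq.1, hq.2, fun j => ?_, ?_⟩
    · rw [← congrFun e1 j]
      have : 0 ≤ s.1 j := hs.1 j
      simp only [Pi.add_apply]
      linarith
    · have : 0 ≤ s.2 := hs.2
      linarith
  have hconv : Convex ℝ (Lm '' K + Ici 0) := by
    refine Convex.add ?_ (convex_Ici 0)
    have : IsLinearMap ℝ Lm := by
      constructor
      · intro x y
        ext <;> simp [hL, Finset.sum_add_distrib, mul_add]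
      · intro s x
        ext <;> simp [hL, Finset.mul_sum, mul_left_comm]
    exact hKconv.is_linear_image this
  have hclosed : IsClosed (Lm '' K + Ici (0 : (J → ℝ) × ℝ)) := isClosed_Ici.add_left_of_isCompact (hKc.image hLc)
  obtain ⟨f, u, hu1, hu2⟩ := geometric_hahn_banach_point_closed hconv hclosed hS
  set ψ : J → ℝ := fun j => f (Pi.single j 1, 0) with hψ
  set l := f (0, 1) with hl
  have hf : ∀ y w, f (y, w) = ∑ j, ψ j * y j + l * w := by
    intro y w
    have : ((y, w) : (J → ℝ) × ℝ) = ∑ j, y j • ((Pi.single j 1, 0) : (J → ℝ) × ℝ) + w • (0, 1) := by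
      ext j
      · simp [Prod.fst_sum, Finset.sum_apply, Pi.single_apply]
      · simp [Prod.snd_sum]
    rw [this, map_add, map_sum, map_smul]
    simp only [map_smul, smul_eq_mul]
    congr 1
    · exact Finset.sum_congr rfl fun j _ => mul_comm _ _
    · rw [mul_comm]
  -- a point in K for each selection
  let Q : (I → J) → (I → J → ℝ) := fun g i j => if j = g i then a i else 0
  have hQ : ∀ g, Q g ∈ K := fun g => ⟨fun i j => by simp only [Q]; split_ifs <;> simp [ha], fun i => by simp [Q]⟩
  have hfS : ∀ g s t, (∀ j, 0 ≤ s j) → 0 ≤ t → u < f (Lm (Q g) + (s, t)) := fun g s t hs ht =>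
    hu2 _ (add_mem_add (mem_image_of_mem _ (hQ g)) ⟨hs, ht⟩)
  have g0 : I → J := fun _ => Classical.arbitrary J
  have hpos : ∀ s t, (∀ j, 0 ≤ s j) → 0 ≤ t → 0 ≤ f (s, t) := by
    intro s t hs ht
    by_contra! hneg
    have := hfS g0 (fun j => ((|f (Lm (Q g0))| + |u|) / (-f (s, t))) * s j) (((|f (Lm (Q g0))| + |u|) / (-f (s, t))) * t)
      (fun j => mul_nonneg (div_nonneg (by positivity) (by linarith)) (hs j))
      (mul_nonneg (div_nonneg (by positivity) (by linarith)) ht)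
    have e : (((fun j => ((|f (Lm (Q g0))| + |u|) / (-f (s, t))) * s j), (((|f (Lm (Q g0))| + |u|) / (-f (s, t))) * t)) : (J → ℝ) × ℝ)
      = ((|f (Lm (Q g0))| + |u|) / (-f (s, t))) • (s, t) := by ext <;> simp
    rw [e, map_add, map_smul, smul_eq_mul] at this
    have e2 : (|f (Lm (Q g0))| + |u|) / (-f (s, t)) * f (s, t) = - (|f (Lm (Q g0))| + |u|) := by
      have : f (s, t) ≠ 0 := hneg.ne
      field_simp
    rw [e2] at this
    have := le_abs_self (f (Lm (Q g0)))
    have := neg_abs_le u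
    linarith
  have hψ0 : ∀ j, 0 ≤ ψ j := fun j => hpos _ _ (fun i => by by_cases hh : i = j <;> simp [Pi.single_apply, hh]) le_rfl
  have hl0 : 0 ≤ l := hpos _ _ (fun i => le_rfl) zero_le_one
  have hmin : ∀ i, ∃ j0, ∀ j, ψ j0 + l * c i j0 ≤ ψ j + l * c i j := fun i =>
    Finite.exists_min fun j => ψ j + l * c i j
  choose g hg using hmin
  have hmain : ∑ j, ψ j * b j + l * V < ∑ i, (ψ (g i) + l * c i (g i)) * a i := by
    have h1 := hfS g 0 0 (fun _ => le_rfl) le_rfl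
    rw [show ((0 : J → ℝ), (0 : ℝ)) = 0 from rfl, add_zero] at h1
    have h2 : f (Lm (Q g)) = ∑ i, (ψ (g i) + l * c i (g i)) * a i := by
      simp only [hL, hf]
      have e1 : ∑ j, ψ j * ∑ i, Q g i j = ∑ i, ψ (g i) * a i := by
        simp only [Finset.mul_sum]
        rw [Finset.sum_comm]
        simp [Q]
      rw [e1]
      simp [Q, Finset.mul_sum, add_mul, Finset.sum_add_distrib, mul_assoc]
    rw [← hf, ← h2]
    exact hu1.trans h1
  rcases hl0.eq_or_lt with hz | hlp
  · rw [← hz] at hmain hg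
    simp only [zero_mul, add_zero] at hmain hg
    set d := ∑ i, ψ (g i) * a i - ∑ j, ψ j * b j with hd
    have hdp : 0 < d := by linarith
    have := h (fun i => ((|V| + 1) / d) * ψ (g i)) (fun j => ((|V| + 1) / d) * ψ j) (fun j => mul_nonneg (by positivity) (hψ0 j))
      (fun i j => by
        have := hg i j
        have h3 : (|V| + 1) / d * ψ (g i) ≤ (|V| + 1) / d * ψ j := by gcongr
        linarith [hc i j])
    simp only [mul_assoc, ← Finset.mul_sum] at this
    have e : (|V| + 1) / d * d = |V| + 1 := by field_simp
    rw [hd, mul_sub, ← hd] at e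
    have := le_abs_self V
    linarith
  · have := h (fun i => (1 / l) * (ψ (g i) + l * c i (g i))) (fun j => (1 / l) * ψ j) (fun j => mul_nonneg (by positivity) (hψ0 j))
      (fun i j => by
        have h3 : (1 / l) * (ψ (g i) + l * c i (g i)) ≤ (1 / l) * (ψ j + l * c i j) := by exact mul_le_mul_of_nonneg_left (hg i j) (by positivity)
        have e : (1 / l) * (ψ j + l * c i j) = (1 / l) * ψ j + c i j := by field_simp
        linarith)
    simp only [mul_assoc, ← Finset.mul_sum] at this
    have h4 : l * (1 / l * ∑ i, (ψ (g i) + l * c i (g i)) * a i) ≤ l * (1 / l * ∑ j, ψ j * b j + V) := by gcongr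
    have e1 : l * (1 / l * ∑ i, (ψ (g i) + l * c i (g i)) * a i) = ∑ i, (ψ (g i) + l * c i (g i)) * a i := by field_simp
    have e2 : l * (1 / l * ∑ j, ψ j * b j + V) = ∑ j, ψ j * b j + l * V := by field_simp
    linarith

end

section

variable {N : ℕ}

lemma wd_fst {α : Type*} [MeasurableSpace α] (a b : Measure α) [SFinite a] [SFinite b] {G : α × α → ℝ≥0∞}
    (hG : Measurable G) : ((a.prod b).withDensity G).map Prod.fst = a.withDensity fun x => ∫⁻ y, G (x, y) ∂b := by
  ext A hA
  rw [Measure.map_apply measurable_fst hA, withDensity_apply _ (measurable_fst hA), withDensity_apply _ hA,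
    show (Prod.fst ⁻¹' A : Set (α × α)) = A ×ˢ univ by ext; simp, setLIntegral_prod _ hG.aemeasurable]
  simp

lemma wd_snd {α : Type*} [MeasurableSpace α] (a b : Measure α) [SFinite a] [SFinite b] {G : α × α → ℝ≥0∞}
    (hG : Measurable G) : ((a.prod b).withDensity G).map Prod.snd = b.withDensity fun y => ∫⁻ x, G (x, y) ∂a := by
  ext A hA
  rw [Measure.map_apply measurable_snd hA, withDensity_apply _ (measurable_snd hA), withDensity_apply _ hA,
    show (Prod.snd ⁻¹' A : Set (α × α)) = univ ×ˢ A by ext; simp, setLIntegral_prod_symm _ hG.aemeasurable]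
  simp

lemma lint_fin {α I : Type*} [MeasurableSpace α] [Fintype I] [MeasurableSpace I] [MeasurableSingletonClass I]
    {k : α → I} (hk : Measurable k) (g : I → ℝ≥0∞) (μ : Measure α) :
    ∫⁻ x, g (k x) ∂μ = ∑ i, g i * μ (k ⁻¹' {i}) := by
  have hg : Measurable g := measurable_of_finite g
  rw [← lintegral_map hg hk, lintegral_fintype]
  refine Finset.sum_congr rfl fun i _ => ?_
  rw [Measure.map_apply hk (measurableSet_singleton i)]

lemma meas_cost (N : ℕ) (p : ℝ) : Measurable fun z : Euc N × Euc N => ENNReal.ofReal (dist z.1 z.2 ^ p) := by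
  fun_prop

lemma plan_to_energy {ρ : Euc N → ℝ} {p : ℝ} (hρ : Measurable ρ) (h1 : ∀ x, ρ x ≤ 1) (h0 : ∀ x, 0 ≤ ρ x) {m : ℝ}
    (hρm : ∫⁻ x, ENNReal.ofReal (ρ x) = ENNReal.ofReal m)
    {π : Measure (Euc N × Euc N)} (hf : π.map Prod.fst = densM volume ρ)
    (hs : π.map Prod.snd ≤ densM volume fun x => 1 - ρ x) :
    WEnergyPow p volume ρ ≤ tCost p π := by
  have hac : π.map Prod.snd ≪ volume :=
    (Measure.absolutelyContinuous_of_le hs).trans (withDensity_absolutelyContinuous _ _)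
  have huniv : π.map Prod.snd univ = ENNReal.ofReal m := by
    rw [Measure.map_apply measurable_snd .univ, preimage_univ, ← preimage_univ (f := Prod.fst),
      ← Measure.map_apply measurable_fst .univ, hf, densM, withDensity_apply _ .univ, Measure.restrict_univ, hρm]
  have : IsFiniteMeasure (π.map Prod.snd) := ⟨by rw [huniv]; exact ofReal_lt_top⟩
  set g := (π.map Prod.snd).rnDeriv volume with hg
  have hgm : Measurable g := Measure.measurable_rnDeriv _ _
  have hwd : volume.withDensity g = π.map Prod.snd := Measure.withDensity_rnDeriv_eq _ _ hac
  have hgfin : ∀ᵐ x, g x < ⊤ := Measure.rnDeriv_lt_top _ _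
  have hle : ∀ᵐ x, g x ≤ ENNReal.ofReal (1 - ρ x) := by
    refine ae_le_of_forall_setLIntegral_le_of_sigmaFinite hgm fun s hs' _ => ?_
    rw [← withDensity_apply _ hs', hwd, ← withDensity_apply _ hs']
    exact hs s
  have hof : (fun x => ENNReal.ofReal (g x).toReal) =ᵐ[volume] g := by
    filter_upwards [hgfin] with x hx
    exact ofReal_toReal hx.ne
  have hd : densM volume (fun x => (g x).toReal) = π.map Prod.snd := by
    rw [densM, withDensity_congr_ae hof, hwd]
  refine iInf₂_le_of_le (fun x => (g x).toReal) ⟨hgm.ennreal_toReal, fun x => toReal_nonneg, ?_, ?_⟩ ?_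
  · filter_upwards [hle] with x hx
    have := toReal_mono ofReal_ne_top hx
    rw [toReal_ofReal (by linarith [h1 x])] at this
    linarith
  · rw [hρm, ← huniv, ← hd, densM, withDensity_apply _ .univ, Measure.restrict_univ]
  · exact iInf₂_le_of_le π ⟨hf, hd.symm⟩ le_rfl

lemma tail_plan (hN : 1 ≤ N) {p m : ℝ} (hp : 1 < p) (hm : 0 < m) {μ ν : Measure (Euc N)}
    (hμν : μ + ν = volume) (hμ : μ univ = ENNReal.ofReal m) {X : Set (Euc N)} (hX : MeasurableSet X)
    {π : Measure (Euc N × Euc N)} (hf : π.map Prod.fst = μ.restrict X) (hs : π.map Prod.snd ≤ ν) :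
    ∃ π' : Measure (Euc N × Euc N), π'.map Prod.fst = μ ∧ π'.map Prod.snd ≤ ν ∧
      tCost p π' ≤ tCost p π + ENNReal.ofReal (rad N (3 * m) ^ p) * μ Xᶜ := by
  have hπuniv : π.map Prod.snd univ ≤ ENNReal.ofReal m := by
    rw [Measure.map_apply measurable_snd .univ, preimage_univ, ← preimage_univ (f := Prod.fst),
      ← Measure.map_apply measurable_fst .univ, hf, ← hμ]
    exact Measure.restrict_apply_le _ _
  have : IsFiniteMeasure (π.map Prod.snd) := ⟨lt_of_le_of_lt hπuniv ofReal_lt_top⟩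
  have : IsFiniteMeasure μ := ⟨by rw [hμ]; exact ofReal_lt_top⟩
  set s := ν - π.map Prod.snd with hsdef
  have hsν : s + π.map Prod.snd = ν := Measure.sub_add_cancel_of_le hs
  have hsvol : s ≤ volume := by
    rw [← hμν, ← hsν]
    intro A
    simp only [Measure.coe_add, Pi.add_apply]
    rw [add_comm, add_assoc]
    exact le_self_add
  have : SigmaFinite s := Measure.sigmaFinite_of_le volume hsvol
  set D := rad N (3 * m) with hD
  set Z : Euc N → ℝ≥0∞ := fun x => s (ball x D) with hZ
  have hZm : ∀ x, ENNReal.ofReal m ≤ Z x := by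
    intro x
    have h1 : volume (ball x D) = ENNReal.ofReal (3 * m) := vol_ball_rad hN _ (by linarith)
    rw [← hμν, ← hsν, Measure.add_apply, Measure.add_apply] at h1
    have h2 : μ (ball x D) ≤ ENNReal.ofReal m := hμ ▸ measure_mono (subset_univ _)
    have h3 : π.map Prod.snd (ball x D) ≤ ENNReal.ofReal m := (measure_mono (subset_univ _)).trans hπuniv
    have h4 : ENNReal.ofReal (m + m) + ENNReal.ofReal m ≤ ENNReal.ofReal (m + m) + Z x := by
      rw [← ENNReal.ofReal_add (by linarith) hm.le, show m + m + m = 3 * m by ring, ← h1,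
        ENNReal.ofReal_add hm.le hm.le]
      calc μ (ball x D) + (s (ball x D) + π.map Prod.snd (ball x D))
        ≤ ENNReal.ofReal m + (s (ball x D) + ENNReal.ofReal m) := by gcongr
        _ = _ := by rw [hZ]; ring
    exact (ENNReal.add_le_add_iff_left ofReal_ne_top).1 h4
  have hZfin : ∀ x, Z x ≠ ⊤ := fun x => ne_top_of_le_ne_top (measure_ball_lt_top (μ := volume) (x := x) (r := D)).ne (hsvol _)
  have hballm : MeasurableSet {z : Euc N × Euc N | dist z.2 z.1 < D} :=
    measurableSet_lt (by fun_prop) measurable_const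
  have hZmeas : Measurable Z := measurable_measure_prodMk_left hballm
  set τ := μ.restrict Xᶜ with hτ
  have hm0 : ENNReal.ofReal m ≠ 0 := by simpa using hm
  have hZ0 : ∀ x, Z x ≠ 0 := fun x h => by
    have := hZm x
    rw [h] at this
    exact hm0 (le_antisymm this zero_le)
  set G : Euc N × Euc N → ℝ≥0∞ := {z : Euc N × Euc N | dist z.2 z.1 < D}.indicator fun z => (Z z.1)⁻¹ with hG
  have hGm : Measurable G := (Measurable.inv (hZmeas.comp measurable_fst)).indicator hballm
  have hG1 : ∀ x, ∫⁻ y, G (x, y) ∂s = 1 := by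
    intro x
    have : (fun y => G (x, y)) = (ball x D).indicator fun _ => (Z x)⁻¹ := by
      ext y
      simp [hG, indicator, mem_ball]
    rw [this, lintegral_indicator_const measurableSet_ball]
    exact ENNReal.inv_mul_cancel (hZ0 x) (hZfin x)
  have hGle : ∀ z, G z ≤ (ENNReal.ofReal m)⁻¹ := fun z =>
    indicator_le (fun z _ => ENNReal.inv_le_inv.2 (hZm z.1)) z
  have hG2 : ∀ y, ∫⁻ x, G (x, y) ∂τ ≤ 1 := by
    intro y
    calc ∫⁻ x, G (x, y) ∂τ ≤ ∫⁻ x, (ENNReal.ofReal m)⁻¹ ∂τ := lintegral_mono fun x => hGle _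
      _ = (ENNReal.ofReal m)⁻¹ * μ Xᶜ := by simp [hτ]
      _ ≤ (ENNReal.ofReal m)⁻¹ * ENNReal.ofReal m := by gcongr; rw [← hμ]; exact measure_mono (subset_univ _)
      _ = 1 := ENNReal.inv_mul_cancel hm0 ofReal_ne_top
  set π2 := (τ.prod s).withDensity G with hπ2
  refine ⟨π + π2, ?_, ?_, ?_⟩
  · rw [Measure.map_add _ _ measurable_fst, hf, hπ2, wd_fst _ _ hGm]
    simp only [hG1]
    rw [show (fun _ : Euc N => (1 : ℝ≥0∞)) = 1 from rfl, withDensity_one, hτ, Measure.restrict_add_restrict_compl hX]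
  · rw [Measure.map_add _ _ measurable_snd, hπ2, wd_snd _ _ hGm]
    calc π.map Prod.snd + s.withDensity (fun y => ∫⁻ x, G (x, y) ∂τ) ≤ π.map Prod.snd + s.withDensity 1 := by
          gcongr
          exact withDensity_mono (ae_of_all _ hG2)
      _ = ν := by rw [withDensity_one, add_comm, hsν]
  · rw [tCost, lintegral_add_measure]
    refine add_le_add le_rfl ?_
    rw [hπ2, lintegral_withDensity_eq_lintegral_mul _ hGm (meas_cost N p)]
    calc ∫⁻ z, (G * fun z : Euc N × Euc N => ENNReal.ofReal (dist z.1 z.2 ^ p)) z ∂(τ.prod s)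
        ≤ ∫⁻ z, ENNReal.ofReal (D ^ p) * G z ∂(τ.prod s) := by
          refine lintegral_mono fun z => ?_
          simp only [Pi.mul_apply, hG, indicator]
          split_ifs with h
          · rw [mul_comm]
            gcongr
            rw [dist_comm]
            exact le_of_lt h
          · simp
      _ = ENNReal.ofReal (D ^ p) * ∫⁻ x, ∫⁻ y, G (x, y) ∂s ∂τ := by
          rw [lintegral_const_mul _ hGm, lintegral_prod _ hGm.aemeasurable]
      _ = _ := by simp [hG1, hτ]

end

section

variable {N : ℕ}

lemma exists_part {X : Set (Euc N)} (hX : IsCompact X) {h : ℝ} (hh : 0 < h) :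
    ∃ f : SimpleFunc (Euc N) (Euc N), ∀ x ∈ X, dist (f x) x < h := by
  let e := TopologicalSpace.denseSeq (Euc N)
  obtain ⟨t, ht⟩ := hX.elim_finite_subcover (fun k : ℕ => ball (e k) h) (fun k => isOpen_ball) (by
    intro x _
    obtain ⟨k, hk⟩ := (TopologicalSpace.denseRange_denseSeq (Euc N)).exists_dist_lt x hh
    exact mem_iUnion.2 ⟨k, hk⟩)
  refine ⟨SimpleFunc.nearestPt e (t.sup id), fun x hx => ?_⟩
  obtain ⟨k, hk, hkx⟩ := mem_iUnion₂.1 (ht hx)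
  have := SimpleFunc.edist_nearestPt_le e x (k := k) (N := t.sup id) (Finset.le_sup (f := id) hk)
  rw [edist_dist, edist_dist, ofReal_le_ofReal_iff dist_nonneg] at this
  rw [mem_ball, dist_comm] at hkx
  linarith

lemma core_plan {p κ T R δ : ℝ} (hp : 1 < p) (hκ : 0 < κ) (hT : 0 < T) (hδ : 0 ≤ δ)
    {μ ν : Measure (Euc N)} [IsFiniteMeasure μ] (hμν : μ + ν = volume) {V : ℝ≥0∞} (hV : V ≠ ⊤)
    (H : ∀ (φ ψ : Euc N → ℝ) (M : ℝ), Measurable φ → Measurable ψ →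
      (∀ x, 0 ≤ φ x) → (∀ x, φ x ≤ M) → (∀ x, 0 ≤ ψ x) → (∀ x, ψ x ≤ M) →
      (∀ x y, 0 < φ x → dist y x < T → φ x ≤ ψ y + (dist y x + κ) ^ p) →
      ∫⁻ x, ENNReal.ofReal (φ x) ∂μ + ENNReal.ofReal δ ≤ ∫⁻ x, ENNReal.ofReal (ψ x) ∂ν + V) :
    ∃ π : Measure (Euc N × Euc N), π.map Prod.fst = μ.restrict (closedBall 0 R) ∧
      π.map Prod.snd ≤ ν ∧ tCost p π + ENNReal.ofReal δ ≤ V := by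
  set X := closedBall (0 : Euc N) (R + T) with hX
  set X1 := closedBall (0 : Euc N) R with hX1
  have hX1X : X1 ⊆ X := closedBall_subset_closedBall (by linarith)
  obtain ⟨f, hf⟩ := exists_part (isCompact_closedBall (0 : Euc N) (R + T)) (h := κ / 4) (by positivity)
  let I := {z // z ∈ f.range}
  let k : Euc N → I := fun x => ⟨f x, f.mem_range_self x⟩
  have hk : Measurable k := f.measurable.subtype_mk
  have : Nonempty I := ⟨k 0⟩
  have hνvol : ν ≤ volume := by
    rw [← hμν]; exact Measure.le_add_left le_rfl
  have : SigmaFinite ν := Measure.sigmaFinite_of_le volume hνvol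
  set μ1 := μ.restrict X1 with hμ1
  set ν1 := ν.restrict X with hν1
  have : IsFiniteMeasure ν1 := ⟨by
    rw [hν1, Measure.restrict_apply_univ]
    exact lt_of_le_of_lt (hνvol _) measure_closedBall_lt_top⟩
  let a : I → ℝ := fun i => (μ1 (k ⁻¹' {i})).toReal
  let b : I → ℝ := fun i => (ν1 (k ⁻¹' {i})).toReal
  have ha : ∀ i, ENNReal.ofReal (a i) = μ1 (k ⁻¹' {i}) := fun i => ofReal_toReal (measure_ne_top _ _)
  have hb : ∀ i, ENNReal.ofReal (b i) = ν1 (k ⁻¹' {i}) := fun i => ofReal_toReal (measure_ne_top _ _)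
  have ha0 : ∀ i, 0 ≤ a i := fun i => toReal_nonneg
  have hb0 : ∀ i, 0 ≤ b i := fun i => toReal_nonneg
  let c : I → I → ℝ := fun i j => (dist i.1 j.1 + κ / 2) ^ p
  have hc : ∀ i j, 0 ≤ c i j := fun i j => by positivity
  have hcl : ∀ x ∈ X, ∀ y ∈ X, dist x y ^ p ≤ c (k x) (k y) := by
    intro x hx y hy
    apply Real.rpow_le_rpow dist_nonneg _ (by linarith)
    change dist x y ≤ dist (f x) (f y) + κ / 2
    have h1 := hf x hx
    have h2 := hf y hy
    have h3 := dist_triangle4 x (f x) (f y) y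
    rw [dist_comm x (f x)] at h3
    linarith
  have hcu : ∀ x ∈ X, ∀ y ∈ X, c (k x) (k y) ≤ (dist y x + κ) ^ p := by
    intro x hx y hy
    apply Real.rpow_le_rpow (by positivity) _ (by linarith)
    change dist (f x) (f y) + κ / 2 ≤ dist y x + κ
    have h1 := hf x hx
    have h2 := hf y hy
    have h3 := dist_triangle4 (f x) x y (f y)
    rw [dist_comm y (f y), dist_comm x y] at h3
    linarith
  obtain ⟨q, hq0, hqa, hqb, hqc⟩ := lp_duality a b c (V.toReal - δ) ha0 hc (by
    intro φ ψ hψ0 hφψ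
    have hind : ∀ (A : Set (Euc N)) (g : I → ℝ) (η : Measure (Euc N)), MeasurableSet A →
        ∫⁻ x, ENNReal.ofReal (A.indicator (fun x => g (k x)) x) ∂η =
          ∑ i, ENNReal.ofReal (g i) * (η.restrict A) (k ⁻¹' {i}) := by
      intro A g η hA
      rw [← lint_fin hk, ← lintegral_indicator hA]
      refine lintegral_congr fun x => ?_
      by_cases hx : x ∈ A <;> simp [hx]
    obtain ⟨M1, hM1⟩ := (Set.finite_range fun i => max (φ i) 0).bddAbove
    obtain ⟨M2, hM2⟩ := (Set.finite_range ψ).bddAbove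
    have hM1' : ∀ i, max (φ i) 0 ≤ M1 := fun i => hM1 ⟨i, rfl⟩
    have hM2' : ∀ i, ψ i ≤ M2 := fun i => hM2 ⟨i, rfl⟩
    have hM10 : 0 ≤ M1 := (le_max_right _ _).trans (hM1' (k 0))
    have hM20 : 0 ≤ M2 := (hψ0 (k 0)).trans (hM2' (k 0))
    have := H (X1.indicator fun x => max (φ (k x)) 0) (X.indicator fun x => ψ (k x)) (M1 + M2)
      (((measurable_of_finite fun i => max (φ i) 0).comp hk).indicator measurableSet_closedBall)
      (((measurable_of_finite ψ).comp hk).indicator measurableSet_closedBall)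
      (fun x => indicator_nonneg (fun x _ => le_max_right _ _) x)
      (fun x => by
        by_cases hx : x ∈ X1
        · rw [indicator_of_mem hx]; linarith [hM1' (k x)]
        · rw [indicator_of_notMem hx]; linarith)
      (fun x => indicator_nonneg (fun x _ => hψ0 _) x)
      (fun x => by
        by_cases hx : x ∈ X
        · rw [indicator_of_mem hx]; linarith [hM2' (k x)]
        · rw [indicator_of_notMem hx]; linarith)
      (fun x y hx hxy => by
        have hx1 : x ∈ X1 := by
          by_contra hn
          rw [indicator_of_notMem hn] at hx
          exact lt_irrefl _ hx
        have hy : y ∈ X := by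
          rw [hX, mem_closedBall]
          have h1 : dist x 0 ≤ R := hx1
          have := dist_triangle y x 0
          linarith
        rw [indicator_of_mem hx1] at hx ⊢
        rw [indicator_of_mem hy]
        have h0 : 0 < φ (k x) := by
          by_contra! hn
          rw [max_eq_right hn] at hx
          exact lt_irrefl _ hx
        rw [max_eq_left h0.le]
        have h1 := hφψ (k x) (k y)
        have h2 := hcu x (hX1X hx1) y hy
        linarith)
    rw [hind X1 (fun i => max (φ i) 0) μ measurableSet_closedBall, hind X ψ ν measurableSet_closedBall] at this
    have e1 : ∑ i, ENNReal.ofReal (max (φ i) 0) * (μ.restrict X1) (k ⁻¹' {i}) = ENNReal.ofReal (∑ i, max (φ i) 0 * a i) := by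
      rw [ENNReal.ofReal_sum_of_nonneg fun i _ => mul_nonneg (le_max_right _ _) (ha0 i)]
      refine Finset.sum_congr rfl fun i _ => ?_
      rw [ENNReal.ofReal_mul (le_max_right _ _), ha]
    have e2 : ∑ i, ENNReal.ofReal (ψ i) * (ν.restrict X) (k ⁻¹' {i}) = ENNReal.ofReal (∑ i, ψ i * b i) := by
      rw [ENNReal.ofReal_sum_of_nonneg fun i _ => mul_nonneg (hψ0 i) (hb0 i)]
      refine Finset.sum_congr rfl fun i _ => ?_
      rw [ENNReal.ofReal_mul (hψ0 i), hb]
    have n1 : 0 ≤ ∑ i, max (φ i) 0 * a i := Finset.sum_nonneg fun i _ => mul_nonneg (le_max_right _ _) (ha0 i)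
    have n2 : 0 ≤ ∑ i, ψ i * b i := Finset.sum_nonneg fun i _ => mul_nonneg (hψ0 i) (hb0 i)
    rw [e1, e2, ← ENNReal.ofReal_add n1 hδ, ← ofReal_toReal hV, ← ENNReal.ofReal_add n2 toReal_nonneg,
      ofReal_le_ofReal_iff (by positivity)] at this
    have h3 : ∑ i, φ i * a i ≤ ∑ i, max (φ i) 0 * a i :=
      Finset.sum_le_sum fun i _ => mul_le_mul_of_nonneg_right (le_max_left _ _) (ha0 i)
    linarith)
  let g : I → I → ℝ≥0∞ := fun i j => ENNReal.ofReal (q i j / (a i * b j))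
  let G : Euc N × Euc N → ℝ≥0∞ := fun z => g (k z.1) (k z.2)
  have hGm : Measurable G :=
    (measurable_of_finite fun ij : I × I => g ij.1 ij.2).comp ((hk.comp measurable_fst).prodMk (hk.comp measurable_snd))
  have qa : ∀ i j, a i = 0 → q i j = 0 := by
    intro i j h
    refine le_antisymm ?_ (hq0 i j)
    rw [← h, ← hqa i]
    exact Finset.single_le_sum (f := fun j => q i j) (fun j _ => hq0 i j) (Finset.mem_univ j)
  have qb : ∀ i j, b j = 0 → q i j = 0 := by
    intro i j h
    refine le_antisymm ?_ (hq0 i j)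
    rw [← h]
    refine le_trans ?_ (hqb j)
    exact Finset.single_le_sum (f := fun i => q i j) (fun i _ => hq0 i j) (Finset.mem_univ i)
  have hgb : ∀ i j, g i j * ν1 (k ⁻¹' {j}) = ENNReal.ofReal (q i j / a i) := by
    intro i j
    rw [← hb, ← ENNReal.ofReal_mul (div_nonneg (hq0 i j) (mul_nonneg (ha0 i) (hb0 j)))]
    congr 1
    by_cases h : b j = 0
    · simp [qb i j h]
    · field_simp
  have hga : ∀ i j, g i j * μ1 (k ⁻¹' {i}) = ENNReal.ofReal (q i j / b j) := by
    intro i j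
    rw [← ha, ← ENNReal.ofReal_mul (div_nonneg (hq0 i j) (mul_nonneg (ha0 i) (hb0 j)))]
    congr 1
    by_cases h : a i = 0
    · simp [qa i j h]
    · field_simp
  refine ⟨(μ1.prod ν1).withDensity G, ?_, ?_, ?_⟩
  · rw [wd_fst _ _ hGm]
    have h1 : ∀ x, ∫⁻ y, G (x, y) ∂ν1 = ENNReal.ofReal (a (k x) / a (k x)) := by
      intro x
      rw [show (∫⁻ y, G (x, y) ∂ν1) = ∫⁻ y, g (k x) (k y) ∂ν1 from rfl, lint_fin hk (g (k x)) ν1]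
      simp only [hgb]
      rw [← ENNReal.ofReal_sum_of_nonneg fun j _ => div_nonneg (hq0 _ j) (ha0 _), ← Finset.sum_div, hqa]
    simp only [h1]
    have h2 : (fun x => ENNReal.ofReal (a (k x) / a (k x))) =ᵐ[μ1] 1 := by
      have : ∀ᵐ x ∂μ1, a (k x) ≠ 0 := by
        rw [ae_iff]
        refine measure_mono_null (t := ⋃ i ∈ {i : I | a i = 0}, k ⁻¹' {i}) ?_ ?_
        · intro x hx
          simp only [ne_eq, not_not, mem_ofPred_eq] at hx
          simp [hx]
        · rw [measure_biUnion_null_iff (Set.to_countable _)]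
          intro i hi
          rw [← ha i, show a i = 0 from hi, ENNReal.ofReal_zero]
      filter_upwards [this] with x hx
      simp [div_self hx]
    rw [withDensity_congr_ae h2, withDensity_one]
  · rw [wd_snd _ _ hGm]
    calc ν1.withDensity (fun y => ∫⁻ x, G (x, y) ∂μ1) ≤ ν1.withDensity 1 := by
          refine withDensity_mono (ae_of_all _ fun y => ?_)
          change (∫⁻ x, (fun i => g i (k y)) (k x) ∂μ1) ≤ 1
          rw [lint_fin hk (fun i => g i (k y)) μ1]
          simp only [hga]
          rw [← ENNReal.ofReal_sum_of_nonneg fun j _ => div_nonneg (hq0 j _) (hb0 _), ← Finset.sum_div]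
          rw [ofReal_le_one]
          exact div_le_one_of_le₀ (hqb _) (hb0 _)
      _ = ν1 := withDensity_one
      _ ≤ ν := Measure.restrict_le_self
  · have hae : ∀ᵐ z ∂(μ1.prod ν1), z.1 ∈ X ∧ z.2 ∈ X := by
      rw [hμ1, hν1, Measure.prod_restrict]
      filter_upwards [ae_restrict_mem (measurableSet_closedBall.prod measurableSet_closedBall)] with z hz
      exact ⟨hX1X hz.1, hz.2⟩
    have hcost : tCost p ((μ1.prod ν1).withDensity G) ≤ ENNReal.ofReal (∑ i, ∑ j, c i j * q i j) := by
      rw [tCost, lintegral_withDensity_eq_lintegral_mul _ hGm (meas_cost N p)]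
      have hm2 : Measurable fun z : Euc N × Euc N => g (k z.1) (k z.2) * ENNReal.ofReal (c (k z.1) (k z.2)) :=
        (measurable_of_finite fun ij : I × I => g ij.1 ij.2 * ENNReal.ofReal (c ij.1 ij.2)).comp ((hk.comp measurable_fst).prodMk (hk.comp measurable_snd))
      calc ∫⁻ z, (G * fun z : Euc N × Euc N => ENNReal.ofReal (dist z.1 z.2 ^ p)) z ∂(μ1.prod ν1)
          ≤ ∫⁻ z, g (k z.1) (k z.2) * ENNReal.ofReal (c (k z.1) (k z.2)) ∂(μ1.prod ν1) := by
            refine lintegral_mono_ae ?_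
            filter_upwards [hae] with z hz
            exact mul_le_mul_right (ofReal_le_ofReal (hcl _ hz.1 _ hz.2)) _
        _ = ∫⁻ x, ∫⁻ y, g (k x) (k y) * ENNReal.ofReal (c (k x) (k y)) ∂ν1 ∂μ1 := by
            rw [lintegral_prod _ hm2.aemeasurable]
        _ = ∫⁻ x, (fun i => ∑ j, g i j * ENNReal.ofReal (c i j) * ν1 (k ⁻¹' {j})) (k x) ∂μ1 := by
            refine lintegral_congr fun x => ?_
            exact lint_fin hk (fun j => g (k x) j * ENNReal.ofReal (c (k x) j)) ν1
        _ = ∑ i, (∑ j, g i j * ENNReal.ofReal (c i j) * ν1 (k ⁻¹' {j})) * μ1 (k ⁻¹' {i}) :=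
            lint_fin hk (fun i => ∑ j, g i j * ENNReal.ofReal (c i j) * ν1 (k ⁻¹' {j})) μ1
        _ = ENNReal.ofReal (∑ i, ∑ j, c i j * q i j) := by
            rw [ENNReal.ofReal_sum_of_nonneg fun i _ => Finset.sum_nonneg fun j _ => mul_nonneg (hc i j) (hq0 i j)]
            refine Finset.sum_congr rfl fun i _ => ?_
            rw [ENNReal.ofReal_sum_of_nonneg fun j _ => mul_nonneg (hc i j) (hq0 i j), Finset.sum_mul]
            refine Finset.sum_congr rfl fun j _ => ?_
            rw [mul_right_comm (g i j), hgb, ENNReal.ofReal_mul (hc i j), mul_comm (ENNReal.ofReal (c i j)), mul_right_comm]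
            congr 1
            rw [← ha, ← ENNReal.ofReal_mul (div_nonneg (hq0 i j) (ha0 i))]
            congr 1
            by_cases h : a i = 0
            · simp [qa i j h]
            · field_simp
    have hn : 0 ≤ ∑ i, ∑ j, c i j * q i j :=
      Finset.sum_nonneg fun i _ => Finset.sum_nonneg fun j _ => mul_nonneg (hc i j) (hq0 i j)
    calc _ ≤ ENNReal.ofReal (∑ i, ∑ j, c i j * q i j) + ENNReal.ofReal δ := by gcongr
      _ = ENNReal.ofReal (∑ i, ∑ j, c i j * q i j + δ) := (ENNReal.ofReal_add hn hδ).symm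
      _ ≤ ENNReal.ofReal V.toReal := ofReal_le_ofReal (by linarith)
      _ = V := ofReal_toReal hV

end

section

variable {N : ℕ}

lemma Vk_bound {p m κ v : ℝ} (hp : 1 < p) (hm : 0 < m) (hκ : 0 ≤ κ) (hκ1 : κ ≤ 1) (hv : v ∈ Ioo 0 m) :
    ENNReal.ofReal ((rad N (m + v) - rad N v + κ) ^ p) ≤ ENNReal.ofReal ((rad N (2 * m) + 1) ^ p) := by
  apply ofReal_le_ofReal
  have h1 := rad_le (N := N) hv.1.le (show v ≤ m + v by linarith)
  have h2 := rad_le (N := N) (show 0 ≤ m + v by linarith [hv.1]) (show m + v ≤ 2 * m by linarith [hv.2])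
  have h3 := rad_nonneg (N := N) hv.1.le
  apply Real.rpow_le_rpow <;> linarith

lemma Vk_fin {p m κ : ℝ} (hp : 1 < p) (hm : 0 < m) (hκ : 0 ≤ κ) (hκ1 : κ ≤ 1) : Vk N p m κ ≠ ⊤ := by
  have : Vk N p m κ ≤ ∫⁻ v in Ioo 0 m, ENNReal.ofReal ((rad N (2 * m) + 1) ^ p) :=
    setLIntegral_mono' measurableSet_Ioo fun v hv => Vk_bound hp hm hκ hκ1 hv
  refine ne_top_of_le_ne_top ?_ this
  simp [ENNReal.mul_eq_top]

lemma Vk_lim {p m : ℝ} (hp : 1 < p) (hm : 0 < m) :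
    Tendsto (fun n : ℕ => Vk N p m (1 / ((n : ℝ) + 1))) atTop (nhds (Vk N p m 0)) := by
  have hle : ∀ n : ℕ, 1 / ((n : ℝ) + 1) ≤ 1 := fun n => by
    rw [div_le_one (by positivity)]; linarith [(Nat.cast_nonneg n : (0 : ℝ) ≤ n)]
  refine tendsto_lintegral_of_dominated_convergence' (fun _ => ENNReal.ofReal ((rad N (2 * m) + 1) ^ p))
    (fun n => (meas_C N p m _ hp).aemeasurable) (fun n => ?_) ?_ (ae_of_all _ fun v => ?_)
  · filter_upwards [ae_restrict_mem measurableSet_Ioo] with v hv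
    exact Vk_bound hp hm (by positivity) (hle n) hv
  · simp [ENNReal.mul_eq_top]
  · refine (ENNReal.continuous_ofReal.tendsto _).comp ?_
    have h1 : Continuous fun κ : ℝ => (rad N (m + v) - rad N v + κ) ^ p :=
      (Real.continuous_rpow_const (by linarith)).comp (by fun_prop)
    exact (h1.tendsto 0).comp tendsto_one_div_add_atTop_nhds_zero_nat

lemma upper (hN : 1 ≤ N) {p m δ : ℝ} (hp : 1 < p) (hm : 0 < m) (hδ : 0 ≤ δ) {ρ : Euc N → ℝ}
    (hρ : Measurable ρ) (h1 : ∀ x, ρ x ≤ 1) (h0 : ∀ x, 0 ≤ ρ x)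
    (hρm : ∫⁻ x, ENNReal.ofReal (ρ x) = ENNReal.ofReal m)
    (H : ∀ (φ ψ : Euc N → ℝ) (M κ T : ℝ), Measurable φ → Measurable ψ →
      (∀ x, 0 ≤ φ x) → (∀ x, φ x ≤ M) → (∀ x, 0 ≤ ψ x) → (∀ x, ψ x ≤ M) → 0 < κ →
      (∀ x y, 0 < φ x → dist y x < T → φ x ≤ ψ y + (dist y x + κ) ^ p) →
      rad N (2 * m) < T →
    ∫⁻ x, ENNReal.ofReal (φ x) ∂(densM volume ρ) + ENNReal.ofReal δ ≤
      ∫⁻ x, ENNReal.ofReal (ψ x) ∂(densM volume fun x => 1 - ρ x) + Vk N p m κ)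
    (hμν : densM volume ρ + (densM volume fun x => 1 - ρ x) = volume)
    (hμ : densM volume ρ univ = ENNReal.ofReal m) :
    WEnergyPow p volume ρ + ENNReal.ofReal δ ≤ Vk N p m 0 := by
  set μ := densM volume ρ with hμd
  have hfin : IsFiniteMeasure μ := ⟨by rw [hμ]; exact ofReal_lt_top⟩
  have hT : 0 ≤ rad N (2 * m) := rad_nonneg (by linarith)
  have key : ∀ κ R : ℝ, 0 < κ → κ ≤ 1 → WEnergyPow p volume ρ + ENNReal.ofReal δ ≤
      Vk N p m κ + ENNReal.ofReal (rad N (3 * m) ^ p) * μ (closedBall 0 R)ᶜ := by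
    intro κ R hκ hκ1
    obtain ⟨π, hf, hs, hc⟩ := core_plan (R := R) hp hκ (T := rad N (2 * m) + 1) (by linarith) hδ hμν
      (Vk_fin (N := N) hp hm hκ.le hκ1) (fun φ ψ M a1 a2 a3 a4 a5 a6 a7 =>
        H φ ψ M κ (rad N (2 * m) + 1) a1 a2 a3 a4 a5 a6 hκ a7 (by linarith))
    obtain ⟨π', hf', hs', hc'⟩ := tail_plan hN hp hm hμν hμ measurableSet_closedBall hf hs
    calc _ ≤ tCost p π' + ENNReal.ofReal δ := by
          gcongr
          exact plan_to_energy hρ h1 h0 hρm hf' hs'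
      _ ≤ (tCost p π + ENNReal.ofReal (rad N (3 * m) ^ p) * μ (closedBall 0 R)ᶜ) + ENNReal.ofReal δ := by gcongr
      _ = (tCost p π + ENNReal.ofReal δ) + ENNReal.ofReal (rad N (3 * m) ^ p) * μ (closedBall 0 R)ᶜ := by ring
      _ ≤ _ := by gcongr
  have tail : Tendsto (fun n : ℕ => μ (closedBall (0 : Euc N) n)ᶜ) atTop (nhds 0) := by
    have := tendsto_measure_iInter_atTop (μ := μ) (s := fun n : ℕ => (closedBall (0 : Euc N) n)ᶜ)
      (fun n => measurableSet_closedBall.compl.nullMeasurableSet)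
      (fun i j hij => compl_subset_compl.2 (closedBall_subset_closedBall (by exact_mod_cast hij)))
      ⟨0, measure_ne_top _ _⟩
    rw [← compl_iUnion, iUnion_closedBall_nat, compl_univ, measure_empty] at this
    exact this
  refine ge_of_tendsto' (Vk_lim hp hm) fun n => ?_
  have hle : 1 / ((n : ℝ) + 1) ≤ 1 := by
    rw [div_le_one (by positivity)]; linarith [(Nat.cast_nonneg n : (0 : ℝ) ≤ n)]
  have t2 : Tendsto (fun k : ℕ => Vk N p m (1 / ((n : ℝ) + 1)) + ENNReal.ofReal (rad N (3 * m) ^ p) * μ (closedBall (0 : Euc N) k)ᶜ)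
      atTop (nhds (Vk N p m (1 / ((n : ℝ) + 1)))) := by
    have := (ENNReal.Tendsto.const_mul tail (a := ENNReal.ofReal (rad N (3 * m) ^ p)) (Or.inr ofReal_ne_top)).const_add (Vk N p m (1 / ((n : ℝ) + 1)))
    simpa using this
  exact ge_of_tendsto' t2 fun k => key _ k (by positivity) hle

lemma dens_split {ρ : Euc N → ℝ} (hρ : Measurable ρ) (h1 : ∀ x, ρ x ≤ 1) (h0 : ∀ x, 0 ≤ ρ x) :
    densM volume ρ + (densM volume fun x => 1 - ρ x) = volume := by
  rw [densM, densM, ← withDensity_add_left hρ.ennreal_ofReal]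
  have : ((fun x => ENNReal.ofReal (ρ x)) + fun x => ENNReal.ofReal (1 - ρ x)) = (1 : Euc N → ℝ≥0∞) := by
    ext x
    simp only [Pi.add_apply, Pi.one_apply]
    rw [← ENNReal.ofReal_add (h0 x) (by linarith [h1 x])]
    simp
  rw [this, withDensity_one]

lemma upper_weak (hN : 1 ≤ N) {p m : ℝ} (hp : 1 < p) (hm : 0 < m) {ρ : Euc N → ℝ}
    (hρ : Measurable ρ) (h1 : ∀ x, ρ x ≤ 1) (h0 : ∀ x, 0 ≤ ρ x)
    (hρm : ∫⁻ x, ENNReal.ofReal (ρ x) = ENNReal.ofReal m) :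
    WEnergyPow p volume ρ ≤ Vk N p m 0 := by
  have hμν := dens_split hρ h1 h0
  have hμ : densM volume ρ univ = ENNReal.ofReal m := by
    rw [densM, withDensity_apply _ .univ, Measure.restrict_univ, hρm]
  have := upper hN hp hm le_rfl hρ h1 h0 hρm (fun φ ψ M κ T a1 a2 a3 a4 a5 a6 a7 a8 a9 => by
    rw [ENNReal.ofReal_zero, add_zero]
    exact dual_bound hN a1 a2 a3 a4 a5 a6 hp a7 a8 hm a9 hμν hμ) hμν hμ
  simpa using this

lemma upper_strict (hN : 1 ≤ N) {p m η : ℝ} (hp : 1 < p) (hm : 0 < m) {ρ : Euc N → ℝ}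
    (hρ : Measurable ρ) (h1 : ∀ x, ρ x ≤ 1) (h0 : ∀ x, 0 ≤ ρ x)
    (hρm : ∫⁻ x, ENNReal.ofReal (ρ x) = ENNReal.ofReal m) (hη : 0 < η) (hηm : η ≤ m)
    (hball : ∀ x, densM volume ρ (ball x (rad N m)) ≤ ENNReal.ofReal (m - η)) :
    WEnergyPow p volume ρ < Vk N p m 0 := by
  have hμν := dens_split hρ h1 h0
  have hμ : densM volume ρ univ = ENNReal.ofReal m := by
    rw [densM, withDensity_apply _ .univ, Measure.restrict_univ, hρm]
  obtain ⟨δ, hδ, hH⟩ := dual_bound_strict hN hp hm hη hηm hμν hμ hball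
  have h := upper hN hp hm hδ.le hρ h1 h0 hρm hH hμν hμ
  have hfin : WEnergyPow p volume ρ ≠ ⊤ := ne_top_of_le_ne_top (Vk_fin (N := N) hp hm le_rfl zero_le_one) (le_self_add.trans h)
  exact lt_of_lt_of_le (ENNReal.lt_add_right hfin (by simpa using hδ)) h

end

section

variable {N : ℕ}

lemma map_vol (hN : 1 ≤ N) (x0 : Euc N) :
    (volume : Measure (Euc N)).map (fun x => om N * dist x x0 ^ N) = (volume : Measure ℝ).restrict (Ici 0) := by
  symm
  have hom := om_pos N
  have hmeas : Measurable fun x : Euc N => om N * dist x x0 ^ N := by fun_prop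
  refine Measure.ext_of_Ico _ _ fun a b hab => ?_
  rw [Measure.map_apply hmeas measurableSet_Ico, Measure.restrict_apply measurableSet_Ico]
  have key : ∀ (x : Euc N) (b : ℝ), om N * dist x x0 ^ N < b ↔ x ∈ ball x0 (rad N (max b 0)) := by
    intro x b
    have h0 : 0 ≤ om N * dist x x0 ^ N := by positivity
    rw [mem_ball]
    constructor
    · intro h
      have := rad_lt hN h0 (lt_max_of_lt_left (b := b) (c := 0) h)
      rwa [rad_of_pow hN dist_nonneg] at this
    · intro h
      by_contra! hb
      have := rad_le (N := N) (le_max_right b 0) (max_le hb h0)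
      rw [rad_of_pow hN dist_nonneg] at this
      linarith
  have e1 : (fun x : Euc N => om N * dist x x0 ^ N) ⁻¹' Ico a b = ball x0 (rad N (max b 0)) \ ball x0 (rad N (max a 0)) := by
    ext x
    rw [mem_preimage, mem_Ico, Set.mem_sdiff, ← key, ← key]
    constructor
    · rintro ⟨h1, h2⟩; exact ⟨h2, not_lt.2 h1⟩
    · rintro ⟨h1, h2⟩; exact ⟨not_lt.1 h2, h1⟩
  have hmab : max a 0 ≤ max b 0 := max_le_max_right 0 hab.le
  rw [e1, measure_sdiff (ball_subset_ball (rad_le (le_max_right _ _) hmab)) measurableSet_ball.nullMeasurableSet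
    measure_ball_lt_top.ne, vol_ball_rad hN _ (le_max_right _ _), vol_ball_rad hN _ (le_max_right _ _),
    ← ENNReal.ofReal_sub _ (le_max_right _ _)]
  have e2 : Ico a b ∩ Ici 0 = Ico (max a 0) b := by
    ext x
    simp only [mem_inter_iff, mem_Ico, mem_Ici, max_le_iff]
    tauto
  rw [e2, Real.volume_Ico]
  rcases le_total b 0 with h | h
  · rw [max_eq_right h, max_eq_right (hab.le.trans h), ENNReal.ofReal_of_nonpos (by linarith)]
    simp
  · rw [max_eq_left h]

def tauF (N : ℕ) (m s : ℝ) : ℝ := rad N (max (om N * s ^ N - m) 0)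
def gF (N : ℕ) (p m s : ℝ) : ℝ := p * (max (s - tauF N m s) 0) ^ (p - 1)
def Gam (N : ℕ) (p m B : ℝ) : ℝ := ∫ s in B..(rad N (2 * m)), gF N p m s
def GG (N : ℕ) (p m B : ℝ) : ℝ := Gam N p m (min B (rad N (2 * m)))
def TT (N : ℕ) (m A : ℝ) : ℝ := rad N (om N * A ^ N + m)
def FF (N : ℕ) (p m A : ℝ) : ℝ := (TT N m A - A) ^ p + Gam N p m (TT N m A)

lemma gF_cont {p m : ℝ} (hp : 1 < p) : Continuous (gF N p m) := by
  have h1 : Continuous (tauF N m) := (rad_cont N).comp (by fun_prop)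
  exact continuous_const.mul ((Real.continuous_rpow_const (by linarith)).comp ((continuous_id.sub h1).max continuous_const))

lemma gF_nonneg {p m s : ℝ} (hp : 1 < p) : 0 ≤ gF N p m s :=
  mul_nonneg (by linarith) (Real.rpow_nonneg (le_max_right _ _) _)

lemma Gam_deriv {p m : ℝ} (hp : 1 < p) (B : ℝ) : HasDerivAt (Gam N p m) (-gF N p m B) B :=
  intervalIntegral.integral_hasDerivAt_left ((gF_cont hp).intervalIntegrable _ _)
    ((gF_cont hp).stronglyMeasurableAtFilter _ _) (gF_cont hp).continuousAt

lemma Gam_cont {p m : ℝ} (hp : 1 < p) : Continuous (Gam N p m) :=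
  continuous_iff_continuousAt.2 fun B => (Gam_deriv hp B).continuousAt

lemma Gam_anti {p m : ℝ} (hp : 1 < p) : Antitone (Gam N p m) :=
  antitone_of_deriv_nonpos (fun B => (Gam_deriv hp B).differentiableAt) fun B => by
    rw [(Gam_deriv hp B).deriv]; linarith [gF_nonneg (N := N) (m := m) (s := B) hp]

lemma Gam_R {p m : ℝ} : Gam N p m (rad N (2 * m)) = 0 := by simp [Gam]

lemma GG_nonneg {p m : ℝ} (hp : 1 < p) (B : ℝ) : 0 ≤ GG N p m B := by
  rw [← Gam_R (N := N) (p := p) (m := m)]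
  exact Gam_anti hp (min_le_right _ _)

lemma FF_le (hN : 1 ≤ N) {p m A B : ℝ} (hp : 1 < p) (hm : 0 < m) (hA : 0 ≤ A) (hAr : A ≤ rad N m) (hB : rad N m ≤ B) :
    FF N p m A ≤ GG N p m B + (B - A) ^ p := by
  have hom := om_pos N
  set R := rad N (2 * m) with hR
  set r := rad N m with hr
  set S := TT N m A with hS
  have hAm : om N * A ^ N ≤ m := by
    rw [← rad_pow hN hm.le]; gcongr
  have hA0 : 0 ≤ om N * A ^ N := by positivity
  have hrS : r ≤ S := rad_le hm.le (by linarith)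
  have hSR : S ≤ R := rad_le (by linarith) (by linarith)
  have hSpow : om N * S ^ N = om N * A ^ N + m := rad_pow hN (by linarith)
  have hr0 : 0 ≤ r := rad_nonneg hm.le
  set H : ℝ → ℝ := fun B => (B - A) ^ p + Gam N p m B with hH
  have hHd : ∀ B, HasDerivAt H (p * (B - A) ^ (p - 1) + -gF N p m B) B := by
    intro B
    have h1 : HasDerivAt (fun B => B - A) 1 B := (hasDerivAt_id B).sub_const A
    have h2 := h1.rpow_const (p := p) (Or.inr hp.le)
    have h3 := h2.add (Gam_deriv (N := N) (m := m) hp B)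
    refine h3.congr_deriv ?_
    simp only [one_mul]
  have hHc : Continuous H := continuous_iff_continuousAt.2 fun B => (hHd B).continuousAt
  have htau_le : ∀ s, r ≤ s → tauF N m s ≤ s := by
    intro s hs
    have h1 : 0 ≤ om N * s ^ N := by have := hr0.trans hs; positivity
    have h2 := rad_le (N := N) (v := max (om N * s ^ N - m) 0) (w := om N * s ^ N) (le_max_right _ _) (max_le (by linarith) h1)
    rwa [rad_of_pow hN (hr0.trans hs)] at h2
  have hup : ∀ s, S ≤ s → A ≤ tauF N m s := by
    intro s hs
    have h1 : om N * S ^ N ≤ om N * s ^ N := by have := hr0.trans hrS; gcongr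
    have h2 := rad_le (N := N) (v := om N * A ^ N) (w := max (om N * s ^ N - m) 0) hA0 (le_max_of_le_left (by linarith))
    rwa [rad_of_pow hN hA] at h2
  have hdn : ∀ s, r ≤ s → s ≤ S → tauF N m s ≤ A := by
    intro s hs0 hs
    have h1 : om N * s ^ N ≤ om N * S ^ N := by have := hr0.trans hs0; gcongr
    have h2 := rad_le (N := N) (v := max (om N * s ^ N - m) 0) (w := om N * A ^ N) (le_max_right _ _) (max_le (by linarith) hA0)
    rwa [rad_of_pow hN hA] at h2
  have hmono : MonotoneOn H (Icc S R) := by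
    refine monotoneOn_of_deriv_nonneg (convex_Icc _ _) hHc.continuousOn (fun x _ => (hHd x).differentiableAt.differentiableWithinAt) fun s hs => ?_
    rw [interior_Icc] at hs
    rw [(hHd s).deriv]
    have h1 := hup s hs.1.le
    have h2 := htau_le s (hrS.trans hs.1.le)
    have h3 : (max (s - tauF N m s) 0) ^ (p - 1) ≤ (s - A) ^ (p - 1) :=
      Real.rpow_le_rpow (le_max_right _ _) (max_le (by linarith) (by linarith)) (by linarith)
    have h4 : p * (max (s - tauF N m s) 0) ^ (p - 1) ≤ p * (s - A) ^ (p - 1) := by gcongr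
    rw [gF]
    linarith
  have hanti : AntitoneOn H (Icc r S) := by
    refine antitoneOn_of_deriv_nonpos (convex_Icc _ _) hHc.continuousOn (fun x _ => (hHd x).differentiableAt.differentiableWithinAt) fun s hs => ?_
    rw [interior_Icc] at hs
    rw [(hHd s).deriv]
    have h1 := hdn s hs.1.le hs.2.le
    have h3 : (s - A) ^ (p - 1) ≤ (max (s - tauF N m s) 0) ^ (p - 1) :=
      Real.rpow_le_rpow (by linarith [hs.1]) (le_max_of_le_left (by linarith)) (by linarith)
    have h4 : p * (s - A) ^ (p - 1) ≤ p * (max (s - tauF N m s) 0) ^ (p - 1) := by gcongr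
    rw [gF]
    linarith
  have hmin : ∀ B, r ≤ B → B ≤ R → H S ≤ H B := by
    intro B h1 h2
    rcases le_total B S with h | h
    · exact hanti ⟨h1, h⟩ ⟨hrS, le_rfl⟩ h
    · exact hmono ⟨le_rfl, hSR⟩ ⟨h, h2⟩ h
  have hFS : FF N p m A = H S := rfl
  rw [hFS]
  refine (hmin (min B R) (le_min hB (hrS.trans hSR)) (min_le_right _ _)).trans ?_
  have h5 : (min B R - A) ^ p ≤ (B - A) ^ p := by
    apply Real.rpow_le_rpow _ (by linarith [min_le_left B R]) (by linarith)
    have : r ≤ min B R := le_min hB (hrS.trans hSR)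
    linarith
  rw [hH, GG]
  simp only
  linarith

lemma lower (hN : 1 ≤ N) {p m : ℝ} (hp : 1 < p) (hm : 0 < m) (x0 : Euc N) :
    Vk N p m 0 ≤ WEnergyPow p volume ((ball x0 (rad N m)).indicator fun _ => (1 : ℝ)) := by
  have hom := om_pos N
  set r := rad N m with hr
  set χ : Euc N → ℝ := (ball x0 r).indicator fun _ => (1 : ℝ) with hχ
  refine le_iInf₂ fun ρ' hA => le_iInf₂ fun π hπ => ?_
  obtain ⟨hρm, hρ0, hρ1, hρmass⟩ := hA
  obtain ⟨hf, hs⟩ := hπ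
  have hGc : Continuous (GG N p m) := (Gam_cont hp).comp (by fun_prop)
  have hTc : Continuous (TT N m) := (rad_cont N).comp (by fun_prop)
  have hFc : Continuous (FF N p m) :=
    ((Real.continuous_rpow_const (by linarith)).comp (hTc.sub continuous_id)).add ((Gam_cont hp).comp hTc)
  have hFm : Measurable fun x : Euc N => ENNReal.ofReal (FF N p m (dist x x0)) :=
    (hFc.measurable.comp (by fun_prop)).ennreal_ofReal
  have hGm : Measurable fun x : Euc N => ENNReal.ofReal (GG N p m (dist x x0)) :=
    (hGc.measurable.comp (by fun_prop)).ennreal_ofReal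
  have hdχ : densM volume χ = volume.restrict (ball x0 r) := by
    rw [densM, ← withDensity_indicator_one measurableSet_ball]
    congr 1
    ext x
    by_cases hx : x ∈ ball x0 r <;> simp [hχ, hx]
  have hρz : ∀ᵐ x, x ∈ ball x0 r → ρ' x = 0 := by
    filter_upwards [hρ1] with x hx hxb
    rw [hχ, indicator_of_mem hxb] at hx
    linarith [hρ0 x]
  have hle' : densM volume ρ' ≤ volume.restrict (ball x0 r)ᶜ := by
    rw [densM, ← withDensity_indicator_one measurableSet_ball.compl]
    refine withDensity_mono ?_
    filter_upwards [hρ1, hρz] with x hx hz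
    by_cases hxb : x ∈ ball x0 r
    · simp [hz hxb]
    · rw [hχ, indicator_of_notMem hxb] at hx
      have : x ∈ (ball x0 r)ᶜ := hxb
      rw [indicator_of_mem this]
      simpa using hx
  have hae1 : ∀ᵐ z ∂π, z.1 ∈ ball x0 r := by
    have : ∀ᵐ x ∂(π.map Prod.fst), x ∈ ball x0 r := by
      rw [hf, hdχ]; exact ae_restrict_mem measurableSet_ball
    exact ae_of_ae_map measurable_fst.aemeasurable this
  have hae2 : ∀ᵐ z ∂π, z.2 ∈ (ball x0 r)ᶜ := by
    have : ∀ᵐ x ∂(π.map Prod.snd), x ∈ (ball x0 r)ᶜ := by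
      rw [hs]
      exact ae_mono hle' (ae_restrict_mem measurableSet_ball.compl)
    exact ae_of_ae_map measurable_snd.aemeasurable this
  have step1 : ∫⁻ x in ball x0 r, ENNReal.ofReal (FF N p m (dist x x0)) ≤
      (∫⁻ y in (ball x0 r)ᶜ, ENNReal.ofReal (GG N p m (dist y x0))) + tCost p π := by
    calc ∫⁻ x in ball x0 r, ENNReal.ofReal (FF N p m (dist x x0))
        = ∫⁻ z, ENNReal.ofReal (FF N p m (dist z.1 x0)) ∂π := by
          rw [← hdχ, ← hf, lintegral_map hFm measurable_fst]
      _ ≤ ∫⁻ z, (ENNReal.ofReal (GG N p m (dist z.2 x0)) + ENNReal.ofReal (dist z.1 z.2 ^ p)) ∂π := by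
          refine lintegral_mono_ae ?_
          filter_upwards [hae1, hae2] with z h1 h2
          rw [mem_ball] at h1
          have h2' : r ≤ dist z.2 x0 := not_lt.1 h2
          rw [← ENNReal.ofReal_add (GG_nonneg hp _) (by positivity)]
          apply ofReal_le_ofReal
          refine (FF_le hN hp hm dist_nonneg h1.le h2').trans ?_
          gcongr
          · linarith
          · have := dist_triangle z.2 z.1 x0
            rw [dist_comm z.2 z.1] at this
            linarith
      _ = (∫⁻ y, ENNReal.ofReal (GG N p m (dist y x0)) ∂(densM volume ρ')) + tCost p π := by
          rw [lintegral_add_right _ (meas_cost N p), ← hs, lintegral_map hGm measurable_snd, tCost]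
      _ ≤ _ := by
          gcongr
  have hθ : Measurable fun x : Euc N => om N * dist x x0 ^ N := by fun_prop
  have hrd : ∀ x : Euc N, rad N (om N * dist x x0 ^ N) = dist x x0 := fun x => rad_of_pow hN dist_nonneg
  have hball : ∀ x : Euc N, x ∈ ball x0 r ↔ om N * dist x x0 ^ N < m := by
    intro x
    rw [mem_ball]
    constructor
    · intro h
      rw [← rad_pow hN hm.le]
      have : N ≠ 0 := by omega
      gcongr
    · intro h
      rw [← hrd x]
      exact rad_lt hN (by positivity) h
  have conv : ∀ (f : ℝ → ℝ), Continuous f → ∀ A : Set ℝ, MeasurableSet A →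
      ∫⁻ x in (fun x : Euc N => om N * dist x x0 ^ N) ⁻¹' A, ENNReal.ofReal (f (dist x x0)) =
      ∫⁻ u in A ∩ Ici 0, ENNReal.ofReal (f (rad N u)) := by
    intro f hfc A hA
    have hm1 : Measurable fun u => ENNReal.ofReal (f (rad N u)) :=
      (hfc.comp (rad_cont N)).measurable.ennreal_ofReal
    rw [← Measure.restrict_restrict hA, ← map_vol hN x0, setLIntegral_map hA hm1 hθ]
    simp only [hrd]
  have e1 : ∫⁻ x in ball x0 r, ENNReal.ofReal (FF N p m (dist x x0)) =
      ∫⁻ u in Ioo 0 m, ENNReal.ofReal (FF N p m (rad N u)) := by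
    have : ball x0 r = (fun x : Euc N => om N * dist x x0 ^ N) ⁻¹' (Iio m) := by
      ext x; exact hball x
    rw [this, conv _ hFc _ measurableSet_Iio, show Iio m ∩ Ici (0 : ℝ) = Ico 0 m by ext; simp [and_comm]]
    rw [Measure.restrict_congr_set Ioo_ae_eq_Ico]
  have e2 : ∫⁻ y in (ball x0 r)ᶜ, ENNReal.ofReal (GG N p m (dist y x0)) =
      ∫⁻ u in Ioo 0 m, ENNReal.ofReal (GG N p m (rad N (m + u))) := by
    have : (ball x0 r)ᶜ = (fun x : Euc N => om N * dist x x0 ^ N) ⁻¹' (Ici m) := by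
      ext x
      rw [mem_compl_iff, hball x, not_lt]; rfl
    rw [this, conv _ hGc _ measurableSet_Ici, Ici_inter_Ici, sup_eq_left.2 hm.le,
      ← lintegral_indicator measurableSet_Ici, ← lintegral_add_left_eq_self _ m,
      Measure.restrict_congr_set (Ioo_ae_eq_Ico (a := (0 : ℝ)) (b := m)), ← lintegral_indicator measurableSet_Ico]
    refine lintegral_congr fun u => ?_
    by_cases hu : 0 ≤ u
    · by_cases hum : u < m
      · rw [indicator_of_mem (show m + u ∈ Ici m from by simpa using hu), indicator_of_mem (show u ∈ Ico 0 m from ⟨hu, hum⟩)]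
      · rw [indicator_of_mem (show m + u ∈ Ici m from by simpa using hu), indicator_of_notMem (fun h : u ∈ Ico 0 m => hum h.2)]
        have : rad N (2 * m) ≤ rad N (m + u) := rad_le (by linarith) (by linarith [not_lt.1 hum])
        rw [GG, min_eq_right this, Gam_R, ENNReal.ofReal_zero]
    · rw [indicator_of_notMem (fun h : m + u ∈ Ici m => hu (by simpa using h)), indicator_of_notMem (fun h : u ∈ Ico 0 m => hu h.1)]
  have e3 : ∫⁻ u in Ioo 0 m, ENNReal.ofReal (FF N p m (rad N u)) =
      Vk N p m 0 + ∫⁻ u in Ioo 0 m, ENNReal.ofReal (GG N p m (rad N (m + u))) := by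
    rw [Vk, ← lintegral_add_left (meas_C N p m 0 hp)]
    refine setLIntegral_congr_fun measurableSet_Ioo fun u hu => ?_
    have h1 : TT N m (rad N u) = rad N (m + u) := by
      rw [TT, rad_pow hN hu.1.le, add_comm]
    have h2 : rad N (m + u) ≤ rad N (2 * m) := rad_le (by linarith [hu.1]) (by linarith [hu.2])
    have h3 := rad_le (N := N) hu.1.le (show u ≤ m + u by linarith)
    rw [← ENNReal.ofReal_add (Real.rpow_nonneg (by linarith) _) (GG_nonneg hp _), FF, h1, GG, min_eq_left h2, add_zero]
  have hfin : ∫⁻ u in Ioo 0 m, ENNReal.ofReal (GG N p m (rad N (m + u))) ≠ ⊤ := by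
    have : ∫⁻ u in Ioo 0 m, ENNReal.ofReal (GG N p m (rad N (m + u))) ≤ ∫⁻ u in Ioo 0 m, ENNReal.ofReal (Gam N p m 0) := by
      refine setLIntegral_mono' measurableSet_Ioo fun u hu => ofReal_le_ofReal (Gam_anti hp ?_)
      exact le_min (rad_nonneg (by linarith [hu.1])) (rad_nonneg (by linarith))
    refine ne_top_of_le_ne_top ?_ this
    simp [ENNReal.mul_eq_top]
  rw [e1, e2, e3, add_comm] at step1
  exact (ENNReal.add_le_add_iff_left hfin).1 step1

end

section

variable {N : ℕ}

lemma WE_congr_le {p : ℝ} {ρ σ : Euc N → ℝ} (h : ρ =ᵐ[volume] σ) :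
    WEnergyPow p volume ρ ≤ WEnergyPow p volume σ := by
  have h' : (fun x => ENNReal.ofReal (ρ x)) =ᵐ[volume] fun x => ENNReal.ofReal (σ x) := by
    filter_upwards [h] with x hx
    rw [hx]
  refine le_iInf₂ fun ρ' hA => ?_
  obtain ⟨h1, h2, h3, h4⟩ := hA
  refine iInf₂_le_of_le ρ' ⟨h1, h2, ?_, ?_⟩ ?_
  · filter_upwards [h, h3] with x hx hx3
    rwa [hx]
  · rw [h4, lintegral_congr_ae h']
  · rw [densM, densM, densM, withDensity_congr_ae h']

lemma WE_congr {p : ℝ} {ρ σ : Euc N → ℝ} (h : ρ =ᵐ[volume] σ) :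
    WEnergyPow p volume ρ = WEnergyPow p volume σ := le_antisymm (WE_congr_le h) (WE_congr_le h.symm)

lemma clamp {m : ℝ} (hm : 0 < m) {ρ : Euc N → ℝ} (hρ : memA volume m ρ) :
    ∃ σ : Euc N → ℝ, ρ =ᵐ[volume] σ ∧ Measurable σ ∧ (∀ x, σ x ≤ 1) ∧ (∀ x, 0 ≤ σ x) ∧
      ∫⁻ x, ENNReal.ofReal (σ x) = ENNReal.ofReal m := by
  obtain ⟨h1, h2, h3⟩ := hρ
  have hae : ρ =ᵐ[volume] fun x => max 0 (min 1 (ρ x)) := by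
    filter_upwards [h2] with x hx
    rw [min_eq_right hx.2, max_eq_right hx.1]
  refine ⟨fun x => max 0 (min 1 (ρ x)), hae, by fun_prop, fun x => max_le zero_le_one (min_le_left _ _), fun x => le_max_left _ _, ?_⟩
  have hint : Integrable ρ volume := by
    by_contra hn
    rw [integral_undef hn] at h3
    exact hm.ne h3
  rw [← ofReal_integral_eq_lintegral_ofReal (hint.congr hae) (ae_of_all _ fun x => le_max_left _ _),
    ← integral_congr_ae hae, h3]

lemma attain {m r : ℝ} (hm : 0 < m) (hr : 0 < r) {μ : Measure (Euc N)} (hμ : μ univ = ENNReal.ofReal m)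
    (hμv : μ ≪ volume)
    (h : ∀ η : ℝ, 0 < η → η ≤ m → ∃ x, ENNReal.ofReal (m - η) < μ (ball x r)) :
    ∃ y, ENNReal.ofReal m ≤ μ (ball y r) := by
  have hfin : IsFiniteMeasure μ := ⟨by rw [hμ]; exact ofReal_lt_top⟩
  have hseq : ∀ n : ℕ, ∃ x, ENNReal.ofReal (m - m / (n + 2)) < μ (ball x r) := fun n =>
    h _ (by positivity) (div_le_self hm.le (by linarith [(Nat.cast_nonneg n : (0 : ℝ) ≤ n)]))
  choose x hx using hseq
  have tail : Tendsto (fun n : ℕ => μ (closedBall (0 : Euc N) n)ᶜ) atTop (nhds 0) := by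
    have := tendsto_measure_iInter_atTop (μ := μ) (s := fun n : ℕ => (closedBall (0 : Euc N) n)ᶜ)
      (fun n => measurableSet_closedBall.compl.nullMeasurableSet)
      (fun i j hij => compl_subset_compl.2 (closedBall_subset_closedBall (by exact_mod_cast hij)))
      ⟨0, measure_ne_top _ _⟩
    rw [← compl_iUnion, iUnion_closedBall_nat, compl_univ, measure_empty] at this
    exact this
  obtain ⟨K, hK⟩ := (tail.eventually_lt_const (show (0 : ℝ≥0∞) < ENNReal.ofReal (m / 2) by simpa using hm)).exists
  have hbd : ∀ n, x n ∈ closedBall (0 : Euc N) (K + r) := by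
    intro n
    by_contra hn
    rw [mem_closedBall, not_le] at hn
    have hsub : ball (x n) r ⊆ (closedBall (0 : Euc N) K)ᶜ := by
      intro y hy hyK
      rw [mem_ball] at hy
      rw [mem_closedBall] at hyK
      have := dist_triangle (x n) y 0
      rw [dist_comm (x n) y] at this
      linarith
    have h1 := (hx n).trans_le (measure_mono hsub)
    have h2 := h1.trans hK
    rw [ofReal_lt_ofReal_iff (by positivity)] at h2
    have h3 : m / (n + 2) ≤ m / 2 := by
      gcongr
      linarith [(Nat.cast_nonneg n : (0 : ℝ) ≤ n)]
    linarith
  obtain ⟨y, -, φ, hφ, hlim⟩ := (isCompact_closedBall (0 : Euc N) (K + r)).tendsto_subseq hbd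
  refine ⟨y, ?_⟩
  have hbig : ∀ ε : ℝ, 0 < ε → ENNReal.ofReal m ≤ μ (ball y (r + ε)) := by
    intro ε hε
    have t1 : Tendsto (fun n : ℕ => ENNReal.ofReal (m - m / ((φ n : ℝ) + 2))) atTop (nhds (ENNReal.ofReal m)) := by
      have t0 : Tendsto (fun n : ℕ => ((φ n : ℝ) + 2)) atTop atTop :=
        tendsto_atTop_add_const_right _ _ (tendsto_natCast_atTop_atTop.comp hφ.tendsto_atTop)
      have := (t0.const_div_atTop m).const_sub m
      rw [sub_zero] at this
      exact (ENNReal.continuous_ofReal.tendsto _).comp this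
    refine le_of_tendsto t1 ?_
    filter_upwards [hlim.eventually (ball_mem_nhds y hε)] with n hn
    refine (hx (φ n)).le.trans (measure_mono (ball_subset_ball' ?_))
    have : dist (x (φ n)) y < ε := hn
    linarith
  have hcl : ENNReal.ofReal m ≤ μ (closedBall y r) := by
    have := tendsto_measure_iInter_atTop (μ := μ) (s := fun n : ℕ => ball y (r + 1 / ((n : ℝ) + 1)))
      (fun n => measurableSet_ball.nullMeasurableSet)
      (fun i j hij => ball_subset_ball (by gcongr))
      ⟨0, measure_ne_top _ _⟩
    have e : ⋂ n : ℕ, ball y (r + 1 / ((n : ℝ) + 1)) = closedBall y r := by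
      ext z
      simp only [mem_iInter, mem_ball, mem_closedBall]
      constructor
      · intro hz
        by_contra! hc
        obtain ⟨n, hn⟩ := exists_nat_one_div_lt (sub_pos.2 hc)
        have := hz n
        linarith
      · intro hz n
        have : 0 < 1 / ((n : ℝ) + 1) := by positivity
        linarith
    rw [e] at this
    exact ge_of_tendsto' this fun n => hbig _ (by positivity)
  have hsph : μ (sphere y r) = 0 := hμv (Measure.addHaar_sphere_of_ne_zero _ _ hr.ne')
  rw [← ball_union_sphere] at hcl
  refine hcl.trans ((measure_union_le _ _).trans ?_)
  rw [hsph, add_zero]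

lemma ball_of_full {m r : ℝ} {σ : Euc N → ℝ} (hσ : Measurable σ) (h1 : ∀ x, σ x ≤ 1) (h0 : ∀ x, 0 ≤ σ x)
    (hσm : ∫⁻ x, ENNReal.ofReal (σ x) = ENNReal.ofReal m) {y : Euc N}
    (hv : volume (ball y r) = ENNReal.ofReal m) (hy : ENNReal.ofReal m ≤ densM volume σ (ball y r)) :
    σ =ᵐ[volume] ((ball y r).indicator fun _ => (1 : ℝ)) := by
  rw [densM, withDensity_apply _ measurableSet_ball, ← lintegral_indicator measurableSet_ball] at hy
  set f := (ball y r).indicator fun x => ENNReal.ofReal (σ x) with hf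
  have hle1 : ∀ x, f x ≤ ENNReal.ofReal (σ x) := fun x => indicator_le_self _ _ x
  have hle2 : ∀ x, f x ≤ (ball y r).indicator 1 x := fun x => by
    by_cases hx : x ∈ ball y r
    · simp only [hf, indicator_of_mem hx, Pi.one_apply, ofReal_le_one]; exact h1 x
    · simp [hf, hx]
  have hffin : ∫⁻ x, f x ≠ ⊤ := ne_top_of_le_ne_top (by rw [hσm]; exact ofReal_ne_top) (lintegral_mono hle1)
  have a1 : f =ᵐ[volume] fun x => ENNReal.ofReal (σ x) :=
    ae_eq_of_ae_le_of_lintegral_le (ae_of_all _ hle1) hffin hσ.ennreal_ofReal.aemeasurable (by rw [hσm]; exact hy)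
  have a2 : f =ᵐ[volume] (ball y r).indicator 1 :=
    ae_eq_of_ae_le_of_lintegral_le (ae_of_all _ hle2) hffin (measurable_one.indicator measurableSet_ball).aemeasurable
      (by rw [lintegral_indicator_one measurableSet_ball, hv]; exact hy)
  filter_upwards [a1, a2] with x hx1 hx2
  rw [hx1] at hx2
  by_cases hx : x ∈ ball y r
  · rw [indicator_of_mem hx] at hx2 ⊢
    have := congrArg ENNReal.toReal hx2
    simpa [toReal_ofReal (h0 x)] using this
  · rw [indicator_of_notMem hx] at hx2 ⊢
    exact le_antisymm (ofReal_eq_zero.1 hx2) (h0 x)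

end

/-- Among densities of mass `m` on `ℝ^N`, the characteristic function of any ball of
volume `m` maximizes the Wasserstein energy `𝒲_p`, and it is the unique maximizer up to
translations (i.e. up to a.e. equality with the characteristic function of a ball of
volume `m`). -/
theorem ball_is_unique_maximizer {N : ℕ} (hN : 1 ≤ N) (p : ℝ) (hp : 1 < p)
    (m : ℝ) (hm : 0 < m) (x₀ : Euc N) (r : ℝ)
    (hr : volume (Metric.ball x₀ r) = ENNReal.ofReal m) :
    (∀ ρ : Euc N → ℝ, memA volume m ρ →
      WEnergy p volume ρ ≤
        WEnergy p volume ((Metric.ball x₀ r).indicator fun _ => (1 : ℝ))) ∧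
    (∀ ρ : Euc N → ℝ, memA volume m ρ →
      WEnergy p volume ρ =
        WEnergy p volume ((Metric.ball x₀ r).indicator fun _ => (1 : ℝ)) →
      ∃ y₀ : Euc N,
        ρ =ᵐ[volume] ((Metric.ball y₀ r).indicator fun _ => (1 : ℝ))) := by
  have hr0 : 0 < r := by
    by_contra! hn
    rw [ball_eq_empty.2 hn, measure_empty] at hr
    exact absurd (ofReal_eq_zero.1 hr.symm) (not_le.2 hm)
  have hrm : r = rad N m := by
    have hom := om_pos N
    rw [vol_ball hN _ hr0.le, ENNReal.ofReal_eq_ofReal_iff (by positivity) hm.le] at hr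
    rw [← hr, rad_of_pow hN hr0.le]
  have hlow : Vk N p m 0 ≤ WEnergyPow p volume ((Metric.ball x₀ r).indicator fun _ => (1 : ℝ)) := by
    rw [hrm]; exact lower hN hp hm x₀
  have hp' : 0 < 1 / p := by positivity
  constructor
  · intro ρ hρ
    obtain ⟨σ, hae, hσ, h1, h0, hσm⟩ := clamp hm hρ
    rw [WEnergy, WEnergy, WE_congr hae]
    exact ENNReal.rpow_le_rpow ((upper_weak hN hp hm hσ h1 h0 hσm).trans hlow) hp'.le
  · intro ρ hρ heq
    obtain ⟨σ, hae, hσ, h1, h0, hσm⟩ := clamp hm hρ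
    rw [WEnergy, WEnergy, WE_congr hae] at heq
    have heq' := (ENNReal.rpow_left_injective hp'.ne') heq
    have hμ : densM volume σ univ = ENNReal.ofReal m := by
      rw [densM, withDensity_apply _ .univ, Measure.restrict_univ, hσm]
    obtain ⟨y, hy⟩ := attain (μ := densM volume σ) hm hr0 hμ (withDensity_absolutelyContinuous _ _) (by
      intro η hη hηm
      by_contra! hn
      rw [hrm] at hn
      have := upper_strict hN hp hm hσ h1 h0 hσm hη hηm hn
      rw [heq'] at this
      exact absurd (this.trans_le hlow) (lt_irrefl _))
    refine ⟨y, hae.trans (ball_of_full hσ h1 h0 hσm ?_ hy)⟩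
    rw [hrm]; exact vol_ball_rad hN _ hm.le
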